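/- A function f ∈ 𝒞(P) is W-invariant (i.e. wf = f for every w ∈ W, equivalently f(wλ) = f(λ) for all w ∈ W, λ ∈ P) if and only if 𝒥T_j𝒥⁻¹f = t_j f for every j ∈ {0, 1, …, n}. -/

import Mathlib

noncomputable section

open scoped RealInnerProductSpace BigOperators Classical
open Filter

namespace AffinePieri

variable {V : Type*} [NormedAddCommGroup V] [InnerProductSpace ℝ V] [FiniteDimensional ℝ V]

/-- The coroot `α^∨ = 2α/⟨α,α⟩` of a vector `α`. -/
def coroot (α : V) : V := (2 / ⟪α, α⟫) • α

lemma refl_involutive (α : V) (k : ℝ) :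
    Function.Involutive (fun x : V => x - (⟪x, coroot α⟫ + k) • α) := by
  intro x
  by_cases h : α = 0
  · simp [h, coroot]
  · have hαα : ⟪α, α⟫ ≠ 0 := fun hc => h (inner_self_eq_zero.mp hc)
    have h2 : ⟪α, coroot α⟫ = 2 := by
      rw [coroot, real_inner_smul_right]
      field_simp
    show (x - (⟪x, coroot α⟫ + k) • α) -
        (⟪x - (⟪x, coroot α⟫ + k) • α, coroot α⟫ + k) • α = x
    rw [inner_sub_left, real_inner_smul_left, h2]
    have key : (⟪x, coroot α⟫ + k) +
        (⟪x, coroot α⟫ - (⟪x, coroot α⟫ + k) * 2 + k) = 0 := by ring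
    rw [sub_sub, ← add_smul, key, zero_smul, sub_zero]

/-- The (affine) orthogonal reflection `x ↦ x - (⟨x,α^∨⟩ + k)α` as a permutation of `V`. -/
def reflP (α : V) (k : ℝ) : Equiv.Perm V :=
  Function.Involutive.toPerm _ (refl_involutive α k)

@[simp] lemma reflP_apply (α : V) (k : ℝ) (x : V) :
    reflP α k x = x - (⟪x, coroot α⟫ + k) • α := rfl

/-- The sign of a real number, as an integer. -/
def zsgn (v : ℝ) : ℤ := if 0 < v then 1 else if v < 0 then -1 else 0

/-- Alternating composition `f ∘ g ∘ f ∘ ⋯` with `m` factors, used for braid relations. -/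
def altOp {A : Type*} (f g : A → A) : ℕ → A → A
  | 0 => id
  | (k + 1) => f ∘ altOp g f k

/-- The interaction potential `v_α` entering the Morse (fusion) potential, for a
parameter family `s`. -/
def vintOf (s : V → ℝ) (α : V) (x : ℝ) : ℝ :=
  (1 - s α ^ 2) * ∫ y in (0:ℝ)..x, 1 / (1 - 2 * s α * Real.cos y + s α ^ 2)

/-- All the standing data of the paper: an irreducible reduced crystallographic root
system `R₀` spanning the Euclidean space `V`, with a positive system, simple roots,
highest (short) roots, an admissible pair `(R₀, R̂₀)` encoded by the map `hat` and the
affine root `α₀`, a `W₀`-invariant multiplicity function `t` with values in `(-1,1)`,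
and an integral level `c > 1`. -/
structure Setup (V : Type*) [NormedAddCommGroup V] [InnerProductSpace ℝ V]
    [FiniteDimensional ℝ V] where
  n : ℕ
  npos : 0 < n
  hdim : Module.finrank ℝ V = n
  R0 : Finset V
  zero_not_mem : (0 : V) ∉ R0
  span_top : Submodule.span ℝ (R0 : Set V) = ⊤
  cryst : ∀ α ∈ R0, ∀ β ∈ R0, ∃ k : ℤ, ⟪β, coroot α⟫ = (k : ℝ)
  refl_mem : ∀ α ∈ R0, ∀ β ∈ R0, β - ⟪β, coroot α⟫ • α ∈ R0
  reduced : ∀ α ∈ R0, ∀ r : ℝ, r • α ∈ R0 → r = 1 ∨ r = -1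
  irred : ¬ ∃ A B : Set V, A.Nonempty ∧ B.Nonempty ∧ A ∪ B = (R0 : Set V) ∧
      ∀ α ∈ A, ∀ β ∈ B, ⟪α, β⟫ = 0
  Rpos : Finset V
  pos_subset : Rpos ⊆ R0
  pos_partition : ∀ α ∈ R0, (α ∈ Rpos ↔ -α ∉ Rpos)
  simple : Fin n → V
  simple_mem : ∀ j, simple j ∈ Rpos
  pos_decomp : ∀ α ∈ Rpos, ∃ f : Fin n → ℕ, α = ∑ j, (f j : ℝ) • simple j
  hroot : V
  hroot_mem : hroot ∈ Rpos
  hroot_highest : ∀ β ∈ R0, ∃ f : Fin n → ℕ, hroot - β = ∑ j, (f j : ℝ) • simple j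
  hs : V
  hs_mem : hs ∈ Rpos
  hs_short : ∀ α ∈ R0, ⟪hs, hs⟫ ≤ ⟪α, α⟫
  hs_highest : ∀ β ∈ R0, ⟪β, β⟫ = ⟪hs, hs⟫ →
      ∃ f : Fin n → ℕ, hs - β = ∑ j, (f j : ℝ) • simple j
  hat : V → V
  a0 : V
  admissible : ((∀ α : V, hat α = coroot α) ∧ a0 = -hs) ∨
      ((∀ α : V, hat α = (2 / ⟪hroot, hroot⟫) • α) ∧ a0 = -hroot)
  t : V → ℝ
  t_bound : ∀ α ∈ R0, |t α| < 1
  t_invariant : ∀ α ∈ R0, ∀ β ∈ R0, t (β - ⟪β, coroot α⟫ • α) = t β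
  c : ℤ
  c_gt : 1 < c

namespace Setup

variable (S : Setup V)

/-- `m_α = 2/⟨α, α̂⟩`. -/
def m (α : V) : ℝ := 2 / ⟪α, S.hat α⟫

/-- The finite Weyl group `W₀`, generated by the reflections in the roots. -/
def W0 : Subgroup (Equiv.Perm V) :=
  Subgroup.closure {w | ∃ α ∈ S.R0, w = reflP α 0}

/-- The affine Weyl group `W`, generated by the affine reflections
`s_a` for `a = α^∨ + m_α r c`. -/
def W : Subgroup (Equiv.Perm V) :=
  Subgroup.closure {w | ∃ α ∈ S.R0, ∃ r : ℤ, w = reflP α (S.m α * (r : ℝ) * (S.c : ℝ))}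

/-- The `W₀`-orbit of a vector. -/
def orb (ω : V) : Set V := {x | ∃ w ∈ S.W0, w ω = x}

/-- The weight lattice `P` of `R₀`. -/
def Plat : Set V := {x | ∀ α ∈ S.R0, ∃ k : ℤ, ⟪x, coroot α⟫ = (k : ℝ)}

/-- The root lattice `Q` of `R₀`. -/
def Qlat : Set V := (AddSubgroup.closure (S.R0 : Set V) : Set V)

/-- The semigroup `Q⁺` generated by the positive roots. -/
def Qplus : Set V := (AddSubmonoid.closure (S.Rpos : Set V) : Set V)

/-- The cone `P⁺` of dominant weights. -/
def Pplus : Set V := {x | x ∈ S.Plat ∧ ∀ α ∈ S.Rpos, 0 ≤ ⟪x, coroot α⟫}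

/-- The dominant affine alcove `A_c = {x | 0 ≤ ⟨x,β⟩ ≤ c ∀ β ∈ R̂₀⁺}`. -/
def Alc : Set V := {x | ∀ α ∈ S.Rpos, 0 ≤ ⟪x, S.hat α⟫ ∧ ⟪x, S.hat α⟫ ≤ (S.c : ℝ)}

/-- `P_c = P ∩ A_c`. -/
def Pc : Set V := {x | x ∈ S.Plat ∧ x ∈ S.Alc}

/-- The weight lattice `P̂` of `R̂₀`. -/
def Phat : Set V := {x | ∀ α ∈ S.R0, ∃ k : ℤ, ⟪x, coroot (S.hat α)⟫ = (k : ℝ)}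

/-- `P̂_c = {μ ∈ P̂ | 0 ≤ ⟨μ,α⟩ ≤ c ∀ α ∈ R₀⁺}`. -/
def Phatc : Set V :=
  {x | x ∈ S.Phat ∧ ∀ α ∈ S.Rpos, 0 ≤ ⟪x, α⟫ ∧ ⟪x, α⟫ ≤ (S.c : ℝ)}

/-- The half sum `ρ` of the positive roots of `R₀`. -/
def rho : V := (2⁻¹ : ℝ) • ∑ α ∈ S.Rpos, α

/-- The half sum `ρ̂` of the positive roots of `R̂₀`. -/
def rhoHat : V := (2⁻¹ : ℝ) • ∑ α ∈ S.Rpos, S.hat α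

/-- The coroot lattice `Q̂^∨` of `R̂₀`. -/
def Qhatvee : Set V :=
  (AddSubgroup.closure ((fun α => coroot (S.hat α)) '' (S.R0 : Set V)) : Set V)

/-- The gradient (direction) of the affine simple root `a_j`:
`α₀` for `j = 0` and `α_j` otherwise. -/
def alpha (j : Fin (S.n + 1)) : V :=
  if h : (j : ℕ) = 0 then S.a0 else S.simple ⟨(j : ℕ) - 1, by have := j.isLt; omega⟩

/-- The constant term of the affine simple root `a_j`. -/
def kconst (j : Fin (S.n + 1)) : ℝ := if (j : ℕ) = 0 then (S.c : ℝ) else 0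

/-- The affine simple root `a_j` as an affine function on `V`. -/
def aFun (j : Fin (S.n + 1)) (x : V) : ℝ := ⟪x, coroot (S.alpha j)⟫ + S.kconst j

/-- The simple affine reflections `s_0, s_1, …, s_n`. -/
def sgen (j : Fin (S.n + 1)) : Equiv.Perm V := reflP (S.alpha j) (S.kconst j)

/-- The length of an element of the affine Weyl group: the minimal length of an
expression as a product of the simple reflections. -/
def len (w : Equiv.Perm V) : ℕ :=
  sInf {k | ∃ l : List (Fin (S.n + 1)), l.length = k ∧ (l.map S.sgen).prod = w}

/-- The length of an element of the finite Weyl group w.r.t. the simple reflections. -/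
def len0 (w : Equiv.Perm V) : ℕ :=
  sInf {k | ∃ l : List (Fin S.n), l.length = k ∧
    (l.map fun j => reflP (S.simple j) 0).prod = w}

/-- `l` is a reduced expression for `w`. -/
def IsReducedWord (l : List (Fin (S.n + 1))) (w : Equiv.Perm V) : Prop :=
  (l.map S.sgen).prod = w ∧ l.length = S.len w

/-- The Bruhat partial order on the affine Weyl group. -/
def BruhatLE (v w : Equiv.Perm V) : Prop :=
  ∃ l : List (Fin (S.n + 1)), S.IsReducedWord l w ∧
    ∃ l' : List (Fin (S.n + 1)), l'.Sublist l ∧ (l'.map S.sgen).prod = v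

/-- Evaluation of a function on the weight lattice at a point of `V` (by `0` off `P`). -/
def ev (f : ↥S.Plat → ℂ) (x : V) : ℂ := if h : x ∈ S.Plat then f ⟨x, h⟩ else 0

/-- The integral part `J_j` of the integral-reflection operators. -/
def Jop (j : Fin (S.n + 1)) (f : ↥S.Plat → ℂ) (x : ↥S.Plat) : ℂ :=
  if 0 < Int.floor (S.aFun j x.1) then
    -∑ k ∈ Finset.Icc (1 : ℤ) (Int.floor (S.aFun j x.1)),
      S.ev f (x.1 - (k : ℝ) • S.alpha j)
  else if Int.floor (S.aFun j x.1) < 0 then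
    ∑ k ∈ Finset.Icc (0 : ℤ) (-(Int.floor (S.aFun j x.1)) - 1),
      S.ev f (x.1 + (k : ℝ) • S.alpha j)
  else 0

/-- The integral-reflection operators `T_j = t_j s_j + (t_j - 1) J_j` on `𝒞(P)`. -/
def Top (j : Fin (S.n + 1)) (f : ↥S.Plat → ℂ) (x : ↥S.Plat) : ℂ :=
  (S.t (S.alpha j) : ℂ) * S.ev f ((S.sgen j)⁻¹ x.1) +
    ((S.t (S.alpha j) : ℂ) - 1) * S.Jop j f x

/-- The operator `T_{j₁} ∘ ⋯ ∘ T_{j_ℓ}` attached to a word `l = [j₁, …, j_ℓ]`. -/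
def wordOp (l : List (Fin (S.n + 1))) : (↥S.Plat → ℂ) → (↥S.Plat → ℂ) :=
  l.foldr (fun j g => S.Top j ∘ g) id

/-- `TW` realizes `w ↦ T_w` (via reduced expressions). -/
def IsTW (TW : Equiv.Perm V → (↥S.Plat → ℂ) → (↥S.Plat → ℂ)) : Prop :=
  ∀ w l, S.IsReducedWord l w → TW w = S.wordOp l

/-- `tw` realizes the length multiplicative function `w ↦ t_w` (via reduced expressions). -/
def IsTmult (tw : Equiv.Perm V → ℂ) : Prop :=
  ∀ w l, S.IsReducedWord l w → tw w = (l.map fun j => (S.t (S.alpha j) : ℂ)).prod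

/-- `wmin` realizes `x ↦ w_x`, the unique shortest affine Weyl group element moving `x`
into the dominant alcove. -/
def IsShortest (wmin : V → Equiv.Perm V) : Prop :=
  ∀ x : V, wmin x ∈ S.W ∧ wmin x x ∈ S.Alc ∧
    ∀ w ∈ S.W, w x ∈ S.Alc →
      S.len (wmin x) ≤ S.len w ∧ (S.len w = S.len (wmin x) → w = wmin x)

/-- The positive affine roots, encoded as pairs `(α, r)` representing `α^∨ + m_α r c`. -/
def RplusP : Set (V × ℤ) :=
  {p | p.1 ∈ S.R0 ∧ (1 ≤ p.2 ∨ (p.2 = 0 ∧ p.1 ∈ S.Rpos))}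

/-- The value of the affine root encoded by `p = (α, r)` at a point of `V`. -/
def affval (p : V × ℤ) (x : V) : ℝ :=
  ⟪x, coroot p.1⟫ + S.m p.1 * (p.2 : ℝ) * (S.c : ℝ)

/-- `R[λ] = {a ∈ R⁺ | a(λ) < 0}`. -/
def Raff (lam : V) : Set (V × ℤ) := {p | p ∈ S.RplusP ∧ S.affval p lam < 0}

/-- `t[λ] = ∏_{a ∈ R[λ]} t_{a'}`. -/
def tBr (lam : V) : ℂ := ∏ᶠ p ∈ S.Raff lam, (S.t p.1 : ℂ)

/-- `θ(λ) = |{a ∈ R⁺ | a(λ) = -2}|`. -/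
def thetaCt (lam : V) : ℕ :=
  Set.ncard {p : V × ℤ | p ∈ S.RplusP ∧ S.affval p lam = -2}

/-- The affine intertwining operator `𝒥`, defined via `wmin` and `TW`. -/
def JJ (wmin : V → Equiv.Perm V) (TW : Equiv.Perm V → (↥S.Plat → ℂ) → (↥S.Plat → ℂ))
    (f : ↥S.Plat → ℂ) (x : ↥S.Plat) : ℂ :=
  (S.tBr x.1)⁻¹ * S.ev (TW (wmin x.1) f) (wmin x.1 x.1)

/-- The Morse (fusion-potential) function `𝒱_μ` for a parameter family `s`. -/
def MorseOf (s : V → ℝ) (μ ξ : V) : ℝ :=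
  ((S.c : ℝ) / 2) * ⟪ξ, ξ⟫ - 2 * Real.pi * ⟪S.rhoHat + μ, ξ⟫ +
    ∑ α ∈ S.Rpos, (2 / ⟪α, coroot (S.hat α)⟫) * ∫ x in (0:ℝ)..(⟪ξ, α⟫), vintOf s α x

/-- The Morse function `𝒱_μ` for the multiplicity function of the setup. -/
def Morse (μ ξ : V) : ℝ := S.MorseOf S.t μ ξ

/-- The critical equation `cξ + ∑_{α∈R₀⁺} v_α(⟨ξ,α⟩) α̂ = 2π(ρ̂ + μ)`. -/
def CritEq (μ x : V) : Prop :=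
  (S.c : ℝ) • x + ∑ α ∈ S.Rpos, (vintOf S.t α ⟪x, α⟫) • S.hat α =
    (2 * Real.pi) • (S.rhoHat + μ)

/-- Extension of a parameter vector indexed by `R₀` to a function on `V` (by zero). -/
def extParam (s : ↥S.R0 → ℝ) : V → ℝ := fun α => if h : α ∈ S.R0 then s ⟨α, h⟩ else 0

/-- `xi` realizes `μ ↦ ξ_μ`, the unique global minimizer of `𝒱_μ`. -/
def IsMinimizer (xi : V → V) : Prop :=
  ∀ μ ∈ S.Phat, ∀ x : V, x ≠ xi μ → S.Morse μ (xi μ) < S.Morse μ x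

/-- The `c`-function of the Macdonald spherical function. -/
def Cfun (ξ : V) : ℂ :=
  ∏ α ∈ S.Rpos, (1 - (S.t α : ℂ) * Complex.exp (-(Complex.I * (⟪ξ, α⟫ : ℂ)))) /
      (1 - Complex.exp (-(Complex.I * (⟪ξ, α⟫ : ℂ))))

/-- The Macdonald spherical function `M_λ(ξ)`. -/
def Msph (lam ξ : V) : ℂ :=
  ∑ᶠ w ∈ (S.W0 : Set (Equiv.Perm V)),
    S.Cfun (w ξ) * Complex.exp (Complex.I * (⟪w ξ, lam⟫ : ℂ))

/-- The orbit sum `m_ω(e^{iξ})`. -/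
def mSym (ω ξ : V) : ℂ := ∑ᶠ ν ∈ S.orb ω, Complex.exp (Complex.I * (⟪ν, ξ⟫ : ℂ))

/-- The plane wave `e^{iξ} ∈ 𝒞(P)`. -/
def planewave (ξ : V) : ↥S.Plat → ℂ :=
  fun lam => Complex.exp (Complex.I * (⟪lam.1, ξ⟫ : ℂ))

/-- The free operator `L_{ω;1}`. -/
def Lfree (ω : V) (f : ↥S.Plat → ℂ) (x : ↥S.Plat) : ℂ :=
  ∑ᶠ ν ∈ S.orb ω, S.ev f (x.1 + ν)

/-- `φ_ξ = ∑_{v ∈ W₀} T_v e^{iξ}`. -/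
def phiW (TW : Equiv.Perm V → (↥S.Plat → ℂ) → (↥S.Plat → ℂ)) (ξ : V) : ↥S.Plat → ℂ :=
  ∑ᶠ w ∈ (S.W0 : Set (Equiv.Perm V)), TW w (S.planewave ξ)

/-- The affine Macdonald spherical function `Φ_ξ = 𝒥 φ_ξ`. -/
def PhiA (wmin : V → Equiv.Perm V)
    (TW : Equiv.Perm V → (↥S.Plat → ℂ) → (↥S.Plat → ℂ)) (ξ : V) : ↥S.Plat → ℂ :=
  S.JJ wmin TW (S.phiW TW ξ)

/-- Invariance of a lattice function under the affine Weyl group. -/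
def Winv (f : ↥S.Plat → ℂ) : Prop :=
  ∀ w ∈ S.W, ∀ x : ↥S.Plat, S.ev f (w⁻¹ x.1) = f x

/-- A minuscule dominant weight. -/
def Minuscule (ω : V) : Prop := ω ∈ S.Pplus ∧ ∀ α ∈ S.Rpos, ⟪ω, coroot α⟫ ≤ 1

/-- `P_ϑ^⋆`: the orbit of the minuscule and quasi-minuscule weights. -/
def Pstar : Set V :=
  {x | ∃ w ∈ S.W0, ∃ η : V, (S.Minuscule η ∨ η = S.hs) ∧ x = w η}

/-- `ê_t(η) = ∏_{β∈R̂₀⁺} t_β^{⟨η,β^∨⟩/2}`. -/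
def et (η : V) : ℂ :=
  ∏ α ∈ S.Rpos, (S.t α : ℂ) ^ (((⟪η, coroot (S.hat α)⟫ / 2 : ℝ) : ℂ))

/-- `ĥ_t = t_{α₀} ê_t(-α₀^∨)`. -/
def hhat : ℂ := (S.t S.a0 : ℂ) * S.et (-(coroot S.a0))

/-- `e_t(ν) = ∏_{α∈R₀⁺} t_α^{⟨ν,α^∨⟩/2}`. -/
def elit (ν : V) : ℂ :=
  ∏ α ∈ S.Rpos, (S.t α : ℂ) ^ (((⟪ν, coroot α⟫ / 2 : ℝ) : ℂ))

/-- `h_t = t_ϑ e_t(-α₀)`. -/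
def hlit : ℂ := (S.t S.hs : ℂ) * S.elit (-S.a0)

/-- The coefficients `d_{λ,ν}`. -/
def dcoef (lam ν : V) : ℂ :=
  if ν ∈ S.orb S.hs then
    (S.thetaCt (lam + ν) : ℂ) * S.elit (-ν) * S.hlit ^ zsgn ⟪lam, S.hat ν⟫
  else 0

/-- The Pieri coefficients `V_{λ,ν}(t)`. -/
def Vcoef (lam ν : V) : ℂ :=
  (∏ α ∈ S.Rpos, if ⟪lam, S.hat α⟫ = 0 ∧ 0 < ⟪ν, S.hat α⟫ then
      (1 - (S.t α : ℂ) * S.et (S.hat α)) / (1 - S.et (S.hat α)) else 1) *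
  ∏ α ∈ S.Rpos, if ⟪lam, S.hat α⟫ = (S.c : ℝ) ∧ ⟪ν, S.hat α⟫ < 0 then
      (1 - (S.t α : ℂ) * S.hhat * S.et (-(S.hat α))) / (1 - S.hhat * S.et (-(S.hat α)))
    else 1

/-- The Pieri coefficients `U_{λ,ω}(t)`. -/
def Ucoef (wmin : V → Equiv.Perm V) (lam ω : V) : ℂ :=
  (∑ᶠ ν ∈ {ν | ν ∈ S.orb ω ∧ wmin (lam + ν) (lam + ν) = lam}, S.tBr (lam + ν)) +
    (1 - (S.t S.hs : ℂ)⁻¹) *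
      ∑ᶠ ν ∈ {ν | ν ∈ S.orb ω ∧ wmin (lam + ν) lam = lam}, S.dcoef lam ν

/-- The linear part of an affine transformation of `V`. -/
def linp (w : Equiv.Perm V) (x : V) : V := w x - w (0 : V)

/-- The set `[x] = {y | y₊ = x₊, w_y ≤ w_x}`. -/
def bra (wmin : V → Equiv.Perm V) (x : V) : Set V :=
  {y | wmin y y = wmin x x ∧ S.BruhatLE (wmin y) (wmin x)}

/-- The partial order `μ ⪯ λ`. -/
def preceq (wmin : V → Equiv.Perm V) (μ lam : V) : Prop :=
  lam - μ ∈ S.Qlat ∧ convexHull ℝ (S.bra wmin μ) ⊆ convexHull ℝ (S.bra wmin lam)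

/-- The Weyl denominator `δ(ξ)`. -/
def weylDenom (ξ : V) : ℂ :=
  ∏ α ∈ S.Rpos, (Complex.exp (Complex.I * (⟪ξ, α⟫ : ℂ) / 2) -
      Complex.exp (-(Complex.I * (⟪ξ, α⟫ : ℂ) / 2)))

/-- The Weyl character `χ_λ(ξ)`. -/
def chiW (lam ξ : V) : ℂ :=
  (S.weylDenom ξ)⁻¹ * ∑ᶠ w ∈ (S.W0 : Set (Equiv.Perm V)),
    ((-1 : ℂ) ^ S.len0 w) * Complex.exp (Complex.I * (⟪w ξ, lam + S.rho⟫ : ℂ))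

/-- The counting function `N_{λ,ω}`. -/
def Ncount (lam ω : V) : ℕ :=
  Nat.card {j : Fin (S.n + 1) // S.aFun j lam = 0 ∧ S.alpha j ∈ S.orb ω}

end Setup

namespace Setup

variable (S : Setup V)

/-- Nonnegative combinations of simple roots. -/
def NN (v : V) : Prop := ∃ f : Fin S.n → ℝ, (∀ j, 0 ≤ f j) ∧ v = ∑ j, f j • S.simple j

lemma NN_add {u v : V} (hu : S.NN u) (hv : S.NN v) : S.NN (u + v) := by
  obtain ⟨f, hf, rfl⟩ := hu
  obtain ⟨g, hg, rfl⟩ := hv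
  exact ⟨fun j => f j + g j, fun j => add_nonneg (hf j) (hg j), by
    simp [add_smul, Finset.sum_add_distrib]⟩

lemma NN_smul {u : V} {r : ℝ} (hr : 0 ≤ r) (hu : S.NN u) : S.NN (r • u) := by
  obtain ⟨f, hf, rfl⟩ := hu
  exact ⟨fun j => r * f j, fun j => mul_nonneg hr (hf j), by
    simp [mul_smul, Finset.smul_sum]⟩

lemma NN_nat {u : V} (h : ∃ f : Fin S.n → ℕ, u = ∑ j, (f j : ℝ) • S.simple j) : S.NN u := by
  obtain ⟨f, hf⟩ := h
  exact ⟨fun j => f j, fun j => Nat.cast_nonneg _, hf⟩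

lemma NN_pos {α : V} (h : α ∈ S.Rpos) : S.NN α := S.NN_nat (S.pos_decomp α h)

lemma NN_inner {x v : V} (hv : S.NN v) (hx : ∀ j, 0 ≤ ⟪x, S.simple j⟫) : 0 ≤ ⟪x, v⟫ := by
  obtain ⟨f, hf, rfl⟩ := hv
  rw [inner_sum]
  refine Finset.sum_nonneg fun j _ => ?_
  rw [real_inner_smul_right]
  exact mul_nonneg (hf j) (hx j)

lemma root_ne {α : V} (h : α ∈ S.R0) : α ≠ 0 := fun h0 => S.zero_not_mem (h0 ▸ h)

lemma root_inner_pos {α : V} (h : α ∈ S.R0) : 0 < ⟪α, α⟫ :=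
  real_inner_self_pos.mpr (S.root_ne h)

lemma inner_coroot_self {α : V} (h : α ∈ S.R0) : ⟪α, coroot α⟫ = 2 := by
  have := (S.root_inner_pos h).ne'
  rw [coroot, real_inner_smul_right]
  field_simp

lemma root_neg {α : V} (h : α ∈ S.R0) : -α ∈ S.R0 := by
  have := S.refl_mem α h α h
  rw [S.inner_coroot_self h] at this
  convert this using 1
  rw [two_smul]; abel

lemma pos_or {α : V} (h : α ∈ S.R0) : α ∈ S.Rpos ∨ -α ∈ S.Rpos := by
  have := S.pos_partition α h
  tauto

lemma simple_R0 (j : Fin S.n) : S.simple j ∈ S.R0 := S.pos_subset (S.simple_mem j)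

lemma inner_coroot (x α : V) : ⟪x, coroot α⟫ = 2 * ⟪x, α⟫ / ⟪α, α⟫ := by
  rw [coroot, real_inner_smul_right]; ring

lemma refl_norm {α : V} (h : α ∈ S.R0) (β : V) :
    ⟪β - ⟪β, coroot α⟫ • α, β - ⟪β, coroot α⟫ • α⟫ = ⟪β, β⟫ := by
  have h0 := (S.root_inner_pos h).ne'
  rw [inner_sub_left, inner_sub_right, inner_sub_right, real_inner_smul_left,
    real_inner_smul_right, real_inner_smul_right, real_inner_smul_left, inner_coroot,
    real_inner_comm β α]
  field_simp
  ring

lemma span_simple : ⊤ ≤ Submodule.span ℝ (Set.range S.simple) := by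
  rw [← S.span_top, Submodule.span_le]
  intro α hα
  have key : ∀ β ∈ S.Rpos, β ∈ Submodule.span ℝ (Set.range S.simple) := by
    intro β hβ
    obtain ⟨f, hf⟩ := S.pos_decomp β hβ
    rw [hf]
    exact Submodule.sum_mem _ fun j _ => Submodule.smul_mem _ _
      (Submodule.subset_span ⟨j, rfl⟩)
  rcases S.pos_or hα with h | h
  · exact key _ h
  · have := Submodule.neg_mem _ (key _ h)
    rwa [neg_neg] at this

lemma exists_inner (v : Fin S.n → ℝ) : ∃ x : V, ∀ i, ⟪x, S.simple i⟫ = v i := by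
  have hc : Fintype.card (Fin S.n) = Module.finrank ℝ V := by rw [S.hdim]; simp
  let b := basisOfTopLeSpanOfCardEqFinrank S.simple S.span_simple hc
  let L : V →ₗ[ℝ] ℝ := b.constr ℝ v
  refine ⟨(InnerProductSpace.toDual ℝ V).symm (LinearMap.toContinuousLinearMap L), fun i => ?_⟩
  rw [InnerProductSpace.toDual_symm_apply]
  have hb : S.simple i = b i := by simp [b]
  rw [hb]
  simp [L]

lemma hroot_R0 : S.hroot ∈ S.R0 := S.pos_subset S.hroot_mem
lemma hs_R0 : S.hs ∈ S.R0 := S.pos_subset S.hs_mem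

lemma dom_aux {θ : V}
    (h : ∀ j, S.NN (θ - (θ - ⟪θ, coroot (S.simple j)⟫ • S.simple j))) (j : Fin S.n) :
    0 ≤ ⟪θ, S.simple j⟫ := by
  obtain ⟨x, hx⟩ := S.exists_inner (fun _ => 1)
  have h1 := S.NN_inner (h j) (x := x) (fun i => by rw [hx]; norm_num)
  rw [sub_sub_cancel, real_inner_smul_right, hx, mul_one, inner_coroot] at h1
  have h0 := S.root_inner_pos (S.simple_R0 j)
  by_contra hc
  push Not at hc
  have : 2 * ⟪θ, S.simple j⟫ / ⟪S.simple j, S.simple j⟫ < 0 :=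
    div_neg_of_neg_of_pos (by linarith) h0
  linarith

lemma hroot_dom (j : Fin S.n) : 0 ≤ ⟪S.hroot, S.simple j⟫ :=
  S.dom_aux (fun j => S.NN_nat (S.hroot_highest _
    (S.refl_mem _ (S.simple_R0 j) _ S.hroot_R0))) j

lemma hs_dom (j : Fin S.n) : 0 ≤ ⟪S.hs, S.simple j⟫ :=
  S.dom_aux (fun j => S.NN_nat (S.hs_highest _
    (S.refl_mem _ (S.simple_R0 j) _ S.hs_R0) (S.refl_norm (S.simple_R0 j) _))) j

lemma refl_neg_NN {γ δ : V} (hγ : γ ∈ S.R0) (hδ : δ ∈ S.R0)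
    (hdom : ∀ j, 0 ≤ ⟪γ, S.simple j⟫) (hpos : 0 < ⟪δ, γ⟫) :
    S.NN (⟪δ, coroot γ⟫ • γ - δ) := by
  have hm := S.refl_mem γ hγ δ hδ
  rcases S.pos_or hm with h | h
  · exfalso
    have h1 := S.NN_inner (S.NN_pos h) hdom
    have h0 := (S.root_inner_pos hγ).ne'
    rw [inner_sub_right, real_inner_smul_right, inner_coroot, real_inner_comm] at h1
    have : 2 * ⟪δ, γ⟫ / ⟪γ, γ⟫ * ⟪γ, γ⟫ = 2 * ⟪δ, γ⟫ := by field_simp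
    linarith
  · have := S.NN_pos h
    rwa [neg_sub] at this

lemma hroot_inner_pos {δ : V} (hδ : δ ∈ S.R0) (hdom : ∀ j, 0 ≤ ⟪δ, S.simple j⟫) :
    0 < ⟪S.hroot, δ⟫ := by
  have h1 := S.NN_inner (S.NN_nat (S.hroot_highest δ hδ)) hdom
  rw [inner_sub_right, real_inner_comm] at h1
  linarith [S.root_inner_pos hδ]

lemma dom_inner_hs {γ : V} (hγ : γ ∈ S.R0) (hdom : ∀ j, 0 ≤ ⟪γ, S.simple j⟫) :
    0 < ⟪γ, S.hs⟫ := by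
  have h0 := S.hroot_inner_pos hγ hdom
  have h1 := S.NN_inner (S.refl_neg_NN hγ S.hroot_R0 hdom h0) S.hs_dom
  have h2 := S.hroot_inner_pos S.hs_R0 S.hs_dom
  rw [inner_sub_right, real_inner_smul_right, inner_coroot, real_inner_comm _ S.hs,
    real_inner_comm _ S.hs] at h1
  have h3 : 0 < 2 * ⟪S.hroot, γ⟫ / ⟪γ, γ⟫ := div_pos (by linarith) (S.root_inner_pos hγ)
  by_contra hc
  push Not at hc
  nlinarith [mul_nonneg h3.le (neg_nonneg.mpr hc)]

lemma dom_coroot_le {γ : V} (hγ : γ ∈ S.R0) (hdom : ∀ j, 0 ≤ ⟪γ, S.simple j⟫) :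
    S.NN (coroot S.hs - coroot γ) := by
  have hp := S.dom_inner_hs hγ hdom
  have h1 := S.refl_neg_NN S.hs_R0 hγ S.hs_dom hp
  have hg := S.root_inner_pos hγ
  have ht := S.root_inner_pos S.hs_R0
  obtain ⟨k, hk⟩ := S.cryst γ hγ S.hs S.hs_R0
  rw [inner_coroot] at hk
  have hsh := S.hs_short γ hγ
  by_cases h2 : k ≤ 1
  · have hk1 : (k : ℝ) ≤ 1 := by exact_mod_cast h2
    rw [← hk, div_le_one hg] at hk1
    have e : coroot S.hs - coroot γ = (2 / ⟪γ, γ⟫) • (⟪γ, coroot S.hs⟫ • S.hs - γ) +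
        (2 / ⟪S.hs, S.hs⟫ * (1 - 2 * ⟪S.hs, γ⟫ / ⟪γ, γ⟫)) • S.hs := by
      rw [inner_coroot, smul_sub, coroot, coroot, smul_smul, sub_add_eq_add_sub, ← add_smul]
      congr 2
      rw [real_inner_comm S.hs γ]
      field_simp
      ring
    rw [e]
    refine S.NN_add (S.NN_smul (by positivity) h1) (S.NN_smul ?_ (S.NN_pos S.hs_mem))
    refine mul_nonneg (by positivity) ?_
    rw [sub_nonneg, div_le_one hg]
    exact hk1
  · have hk2 : (2 : ℝ) ≤ k := by exact_mod_cast (by omega : (2 : ℤ) ≤ k)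
    rw [← hk, le_div_iff₀ hg] at hk2
    have : ⟪S.hs - γ, S.hs - γ⟫ ≤ 0 := by
      rw [inner_sub_left, inner_sub_right, inner_sub_right, real_inner_comm S.hs γ]
      linarith
    have h3 : S.hs - γ = 0 := by
      rw [← inner_self_eq_zero (𝕜 := ℝ)]
      exact le_antisymm this real_inner_self_nonneg
    rw [sub_eq_zero.mp h3, sub_self]
    exact ⟨0, fun _ => le_rfl, by simp⟩

lemma exists_dom {β : V} (hβ : β ∈ S.R0) :
    ∃ γ ∈ S.R0, (∀ j, 0 ≤ ⟪γ, S.simple j⟫) ∧ S.NN (coroot γ - coroot β) := by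
  obtain ⟨x, hx⟩ := S.exists_inner (fun _ => 1)
  let A := S.R0.filter (fun γ => S.NN (coroot γ - coroot β))
  have hA : A.Nonempty := ⟨β, by
    simp only [A, Finset.mem_filter]
    exact ⟨hβ, 0, fun _ => le_rfl, by simp⟩⟩
  obtain ⟨γ, hγA, hmax⟩ := A.exists_max_image (fun γ => ⟪x, coroot γ⟫) hA
  simp only [A, Finset.mem_filter] at hγA
  refine ⟨γ, hγA.1, fun j => ?_, hγA.2⟩
  by_contra hc
  push Not at hc
  have hj := S.root_inner_pos (S.simple_R0 j)
  have hg := S.root_inner_pos hγA.1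
  set δ := γ - ⟪γ, coroot (S.simple j)⟫ • S.simple j with hδ
  have hδR : δ ∈ S.R0 := S.refl_mem _ (S.simple_R0 j) _ hγA.1
  have hδn : ⟪δ, δ⟫ = ⟪γ, γ⟫ := S.refl_norm (S.simple_R0 j) _
  set q := 2 / ⟪γ, γ⟫ * (-(2 * ⟪γ, S.simple j⟫ / ⟪S.simple j, S.simple j⟫)) with hq
  have hqpos : 0 < q := mul_pos (by positivity) (by
    rw [neg_pos]; exact div_neg_of_neg_of_pos (by linarith) hj)
  have e : coroot δ = coroot γ + q • S.simple j := by
    rw [coroot, hδn, hδ, inner_coroot, coroot, hq, smul_sub, mul_smul, neg_smul, smul_neg,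
      sub_eq_add_neg]
  have hNN : S.NN (coroot δ - coroot β) := by
    rw [e, add_sub_right_comm]
    exact S.NN_add hγA.2 (S.NN_smul hqpos.le (S.NN_pos (S.simple_mem j)))
  have := hmax δ (by simp only [A, Finset.mem_filter]; exact ⟨hδR, hNN⟩)
  simp only [e, inner_add_right, real_inner_smul_right, hx] at this
  linarith

lemma coroot_le_hs {β : V} (hβ : β ∈ S.R0) : S.NN (coroot S.hs - coroot β) := by
  obtain ⟨γ, hγ, hd, h⟩ := S.exists_dom hβ
  have := S.NN_add (S.dom_coroot_le hγ hd) h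
  rwa [sub_add_sub_cancel] at this

lemma coroot_neg (α : V) : coroot (-α) = -coroot α := by
  simp [coroot]

lemma NN_coroot {α : V} (h : α ∈ S.Rpos) : S.NN (coroot α) :=
  S.NN_smul (by have := S.root_inner_pos (S.pos_subset h); positivity) (S.NN_pos h)

lemma c_pos : (0 : ℝ) < S.c := by
  have := S.c_gt
  exact_mod_cast (by omega : (0 : ℤ) < S.c)

lemma m_pos {α : V} (h : α ∈ S.R0) : 0 < S.m α := by
  have h0 := S.root_inner_pos h
  have h1 := S.root_inner_pos S.hroot_R0
  unfold m
  rcases S.admissible with ⟨hh, -⟩ | ⟨hh, -⟩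
  · rw [hh, S.inner_coroot_self h]; norm_num
  · rw [hh, real_inner_smul_right]; positivity

lemma coroot_eq_hat {α : V} (h : α ∈ S.R0) : coroot α = S.m α • S.hat α := by
  have h0 := (S.root_inner_pos h).ne'
  have h1 := (S.root_inner_pos S.hroot_R0).ne'
  unfold m
  rcases S.admissible with ⟨hh, -⟩ | ⟨hh, -⟩
  · rw [hh, S.inner_coroot_self h]; norm_num
  · rw [hh, real_inner_smul_right, smul_smul, coroot]
    congr 1
    field_simp

lemma m_congr {α β : V} (hα : α ∈ S.R0) (hβ : β ∈ S.R0) (h : ⟪α, α⟫ = ⟪β, β⟫) :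
    S.m α = S.m β := by
  unfold m
  rcases S.admissible with ⟨hh, -⟩ | ⟨hh, -⟩
  · rw [hh, hh, S.inner_coroot_self hα, S.inner_coroot_self hβ]
  · rw [hh, hh, real_inner_smul_right, real_inner_smul_right, h]

lemma neg_a0_mem : -S.a0 ∈ S.Rpos := by
  rcases S.admissible with ⟨-, hh⟩ | ⟨-, hh⟩
  · rw [hh, neg_neg]; exact S.hs_mem
  · rw [hh, neg_neg]; exact S.hroot_mem

lemma a0_R0 : S.a0 ∈ S.R0 := by
  have := S.root_neg (S.pos_subset S.neg_a0_mem)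
  rwa [neg_neg] at this

lemma m_a0 : S.m S.a0 = 1 := by
  have h1 := (S.root_inner_pos S.hroot_R0).ne'
  have h2 := S.a0_R0
  rcases S.admissible with ⟨hh, h3⟩ | ⟨hh, h3⟩
  · unfold m; rw [hh, S.inner_coroot_self h2]; norm_num
  · unfold m; rw [hh, h3, real_inner_smul_right, inner_neg_neg]; field_simp

lemma m_neg_a0 : S.m (-S.a0) = 1 := by
  rw [← S.m_a0]
  exact S.m_congr (S.pos_subset S.neg_a0_mem) S.a0_R0 (by simp)

lemma a0_int {β : V} (hβ : β ∈ S.R0) : ∃ k : ℤ, ⟪S.a0, coroot β⟫ = S.m β * k := by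
  have h1 := (S.root_inner_pos S.hroot_R0).ne'
  have h0 := (S.root_inner_pos hβ).ne'
  rcases S.admissible with ⟨hh, h3⟩ | ⟨hh, h3⟩
  · obtain ⟨k, hk⟩ := S.cryst β hβ S.a0 S.a0_R0
    refine ⟨k, ?_⟩
    unfold m; rw [hh, S.inner_coroot_self hβ, hk]; norm_num
  · obtain ⟨k, hk⟩ := S.cryst S.a0 S.a0_R0 β hβ
    refine ⟨k, ?_⟩
    unfold m
    rw [← hk, hh, h3, inner_coroot, inner_coroot, real_inner_smul_right, inner_neg_neg,
      inner_neg_right, inner_neg_left, real_inner_comm]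
    field_simp

lemma NN_level {β : V} (hβ : β ∈ S.R0) {r : ℤ} (hr : 1 ≤ r) :
    S.NN (coroot β - (S.m β * r) • coroot S.a0) := by
  have h1 := S.root_inner_pos S.hroot_R0
  have h0 := S.root_inner_pos hβ
  have hm := S.m_pos hβ
  have key : S.NN (coroot β - S.m β • coroot S.a0) := by
    rcases S.admissible with ⟨hh, h3⟩ | ⟨hh, h3⟩
    · have := S.coroot_le_hs (S.root_neg hβ)
      have hm1 : S.m β = 1 := by unfold m; rw [hh, S.inner_coroot_self hβ]; norm_num
      rw [hm1, h3, coroot_neg, one_smul]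
      rw [coroot_neg] at this
      convert this using 1
      abel
    · have := S.NN_smul (r := 2 / ⟪β, β⟫) (by positivity)
        (S.NN_nat (S.hroot_highest _ (S.root_neg hβ)))
      convert this using 1
      unfold m
      rw [h3, hh, real_inner_smul_right, coroot_neg, coroot, coroot, smul_sub, smul_neg,
        smul_neg, smul_smul, sub_neg_eq_add, sub_neg_eq_add, add_comm]
      congr 2
      field_simp
  have h2 : S.NN ((S.m β * (r - 1)) • coroot (-S.a0)) :=
    S.NN_smul (mul_nonneg hm.le (sub_nonneg.mpr (by exact_mod_cast hr)))
      (S.NN_coroot S.neg_a0_mem)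
  convert S.NN_add key h2 using 1
  rw [coroot_neg, smul_neg, ← sub_eq_add_neg, sub_sub, ← add_smul]
  congr 2
  ring

end Setup


namespace Setup

variable (S : Setup V)

lemma alpha_zero : S.alpha 0 = S.a0 := by simp [alpha]
lemma alpha_succ (i : Fin S.n) : S.alpha i.succ = S.simple i := by simp [alpha]
lemma kconst_zero : S.kconst 0 = S.c := by simp [kconst]
lemma kconst_succ (i : Fin S.n) : S.kconst i.succ = 0 := by simp [kconst]

lemma aFun_zero (x : V) : S.aFun 0 x = ⟪x, coroot S.a0⟫ + S.c := by
  rw [aFun, alpha_zero, kconst_zero]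
lemma aFun_succ (i : Fin S.n) (x : V) : S.aFun i.succ x = ⟪x, coroot (S.simple i)⟫ := by
  rw [aFun, alpha_succ, kconst_succ, add_zero]

lemma alpha_R0 (j : Fin (S.n + 1)) : S.alpha j ∈ S.R0 := by
  refine Fin.cases ?_ (fun i => ?_) j
  · rw [alpha_zero]; exact S.a0_R0
  · rw [alpha_succ]; exact S.simple_R0 i

/-- The pair encoding the simple affine root. -/
def apair (j : Fin (S.n + 1)) : V × ℤ := (S.alpha j, if (j : ℕ) = 0 then 1 else 0)

lemma m_kconst (j : Fin (S.n + 1)) :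
    S.m (S.apair j).1 * ((S.apair j).2 : ℝ) * (S.c : ℝ) = S.kconst j := by
  refine Fin.cases ?_ (fun i => ?_) j
  · simp [apair, alpha_zero, kconst_zero, m_a0]
  · simp [apair, kconst_succ]

lemma affval_apair (j : Fin (S.n + 1)) (x : V) : S.affval (S.apair j) x = S.aFun j x := by
  rw [affval, m_kconst]; rfl

/-- The affine reflection attached to a pair. -/
def rp (p : V × ℤ) : Equiv.Perm V := reflP p.1 (S.m p.1 * (p.2 : ℝ) * (S.c : ℝ))

lemma rp_apair (j : Fin (S.n + 1)) : S.rp (S.apair j) = S.sgen j := by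
  rw [rp, m_kconst]; rfl

lemma rp_apply (p : V × ℤ) (x : V) : S.rp p x = x - S.affval p x • p.1 := rfl

lemma sgen_apply (j : Fin (S.n + 1)) (x : V) :
    S.sgen j x = x - S.aFun j x • S.alpha j := rfl

lemma sgen_sgen (j : Fin (S.n + 1)) (x : V) : S.sgen j (S.sgen j x) = x :=
  refl_involutive _ _ x

lemma sgen_mul_self (j : Fin (S.n + 1)) : S.sgen j * S.sgen j = 1 := by
  ext x; exact S.sgen_sgen j x

lemma sgen_inv (j : Fin (S.n + 1)) : (S.sgen j)⁻¹ = S.sgen j :=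
  inv_eq_of_mul_eq_one_left (S.sgen_mul_self j)

lemma aFun_sgen (j : Fin (S.n + 1)) (x : V) : S.aFun j (S.sgen j x) = - S.aFun j x := by
  rw [sgen_apply]
  conv_lhs => rw [aFun]
  rw [inner_sub_left, real_inner_smul_left, S.inner_coroot_self (S.alpha_R0 j)]
  rw [aFun]; ring

lemma apair_pos (j : Fin (S.n + 1)) : S.apair j ∈ S.RplusP := by
  refine ⟨S.alpha_R0 j, ?_⟩
  refine Fin.cases ?_ (fun i => ?_) j
  · left; simp [apair]
  · right; simp [apair, alpha_succ, S.simple_mem]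

lemma NN_comb {v : V} (hv : S.NN v) : ∃ c : Fin S.n → ℝ, (∀ i, 0 ≤ c i) ∧
    ∀ x, ⟪x, v⟫ = ∑ i, c i * S.aFun i.succ x := by
  obtain ⟨f, hf, rfl⟩ := hv
  refine ⟨fun i => f i * (⟪S.simple i, S.simple i⟫ / 2), fun i => ?_, fun x => ?_⟩
  · have := S.root_inner_pos (S.simple_R0 i)
    exact mul_nonneg (hf i) (by positivity)
  · rw [inner_sum]
    refine Finset.sum_congr rfl fun i _ => ?_
    have := (S.root_inner_pos (S.simple_R0 i)).ne'
    rw [aFun_succ, inner_coroot, real_inner_smul_right]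
    field_simp

lemma pos_comb {p : V × ℤ} (hp : p ∈ S.RplusP) : ∃ c : Fin (S.n + 1) → ℝ, (∀ i, 0 ≤ c i) ∧
    ∀ x, S.affval p x = ∑ i, c i * S.aFun i x := by
  obtain ⟨h1, h2 | ⟨h2, h3⟩⟩ := hp
  · obtain ⟨f, hf, hf2⟩ := S.NN_comb (S.NN_level h1 h2)
    have hr : (0 : ℝ) ≤ p.2 := by exact_mod_cast (by omega : 0 ≤ p.2)
    refine ⟨Fin.cons (S.m p.1 * p.2) f, fun i => ?_, fun x => ?_⟩
    · refine Fin.cases ?_ (fun i => ?_) i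
      · exact mul_nonneg (S.m_pos h1).le hr
      · exact hf i
    · rw [Fin.sum_univ_succ]
      simp only [Fin.cons_zero, Fin.cons_succ]
      rw [← hf2, aFun_zero, inner_sub_right, real_inner_smul_right, affval]
      ring
  · obtain ⟨f, hf, hf2⟩ := S.NN_comb (S.NN_coroot h3)
    refine ⟨Fin.cons 0 f, fun i => ?_, fun x => ?_⟩
    · refine Fin.cases ?_ (fun i => ?_) i
      · exact le_rfl
      · exact hf i
    · rw [Fin.sum_univ_succ]
      simp only [Fin.cons_zero, Fin.cons_succ]
      rw [← hf2, affval, h2]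
      simp

lemma pos_nonneg {p : V × ℤ} (hp : p ∈ S.RplusP) {z : V} (hz : ∀ i, 0 ≤ S.aFun i z) :
    0 ≤ S.affval p z := by
  obtain ⟨c, hc, h⟩ := S.pos_comb hp
  rw [h]
  exact Finset.sum_nonneg fun i _ => mul_nonneg (hc i) (hz i)

lemma exists_y (j : Fin (S.n + 1)) : ∃ y, S.aFun j y = 0 ∧ ∀ i, i ≠ j → 0 < S.aFun i y := by
  have hc := S.c_pos
  have hsp : ∀ (i : Fin S.n) (x : V), 0 < ⟪x, S.simple i⟫ → 0 < S.aFun i.succ x := by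
    intro i x hx
    have := S.root_inner_pos (S.simple_R0 i)
    rw [aFun_succ, inner_coroot]; positivity
  refine Fin.cases ?_ (fun j => ?_) j
  · obtain ⟨x, hx⟩ := S.exists_inner (fun _ => 1)
    have hd : 0 ≤ ⟪x, coroot (-S.a0)⟫ :=
      S.NN_inner (S.NN_coroot S.neg_a0_mem) (fun j => by rw [hx]; norm_num)
    have hd0 : ⟪x, coroot (-S.a0)⟫ ≠ 0 := by
      intro h0
      obtain ⟨f, hf⟩ := S.pos_decomp _ S.neg_a0_mem
      have hb := S.root_inner_pos (S.pos_subset S.neg_a0_mem)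
      rw [inner_coroot, div_eq_zero_iff, or_iff_left hb.ne'] at h0
      have h1 : ⟪x, -S.a0⟫ = 0 := by linarith
      rw [hf, inner_sum] at h1
      simp only [real_inner_smul_right, hx, mul_one] at h1
      rw [Finset.sum_eq_zero_iff_of_nonneg (fun i _ => Nat.cast_nonneg _)] at h1
      have : -S.a0 = 0 := by
        rw [hf]
        exact Finset.sum_eq_zero fun i hi => by rw [h1 i hi, zero_smul]
      exact S.root_ne (S.pos_subset S.neg_a0_mem) this
    have hd1 : 0 < ⟪x, coroot (-S.a0)⟫ := lt_of_le_of_ne hd (Ne.symm hd0)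
    refine ⟨((S.c : ℝ) / ⟪x, coroot (-S.a0)⟫) • x, ?_, fun i hi => ?_⟩
    · rw [aFun_zero, real_inner_smul_left]
      rw [coroot_neg, inner_neg_right] at hd0 ⊢
      field_simp
      have : ⟪x, coroot S.a0⟫ ≠ 0 := fun h => hd0 (by rw [h, neg_zero])
      field_simp
      ring
    · obtain ⟨k, rfl⟩ := Fin.exists_succ_eq.mpr hi
      refine hsp _ _ ?_
      rw [real_inner_smul_left, hx]; positivity
  · obtain ⟨x, hx⟩ := S.exists_inner (fun i => if i = j then 0 else 1)
    set d := |⟪x, coroot S.a0⟫| with hd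
    have hd0 : 0 ≤ d := abs_nonneg _
    refine ⟨((S.c : ℝ) / (d + 1)) • x, ?_, fun i hi => ?_⟩
    · rw [aFun_succ, inner_coroot, real_inner_smul_left, hx]; simp
    · revert hi
      refine Fin.cases ?_ (fun k => ?_) i
      · intro _
        rw [aFun_zero, real_inner_smul_left]
        have h1 : -d ≤ ⟪x, coroot S.a0⟫ := neg_abs_le _
        have h2 : (S.c : ℝ) / (d + 1) * ⟪x, coroot S.a0⟫ + S.c =
          S.c / (d + 1) * (⟪x, coroot S.a0⟫ + d + 1) := by field_simp; ring
        rw [h2]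
        exact mul_pos (by positivity) (by linarith)
      · intro hi
        refine hsp _ _ ?_
        have : k ≠ j := fun h => hi (by rw [h])
        rw [real_inner_smul_left, hx, if_neg this]; positivity

/-- A point on the wall `j`. -/
def yw (j : Fin (S.n + 1)) : V := (S.exists_y j).choose
lemma yw_self (j : Fin (S.n + 1)) : S.aFun j (S.yw j) = 0 := (S.exists_y j).choose_spec.1
lemma yw_pos (j : Fin (S.n + 1)) {i : Fin (S.n + 1)} (h : i ≠ j) : 0 < S.aFun i (S.yw j) :=
  (S.exists_y j).choose_spec.2 i h
lemma yw_nonneg (j i : Fin (S.n + 1)) : 0 ≤ S.aFun i (S.yw j) := by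
  by_cases h : i = j
  · rw [h, S.yw_self]
  · exact (S.yw_pos j h).le

lemma exists_x0 : ∃ x, ∀ i, 0 < S.aFun i x := by
  have hn := S.npos
  let k : Fin (S.n + 1) := ⟨1, by omega⟩
  have hk : k ≠ 0 := by intro h; simpa [k] using congrArg Fin.val h
  refine ⟨(1 / 2 : ℝ) • (S.yw 0 + S.yw k), fun i => ?_⟩
  have e : S.aFun i ((1 / 2 : ℝ) • (S.yw 0 + S.yw k)) =
      (S.aFun i (S.yw 0) + S.aFun i (S.yw k)) / 2 := by
    simp only [aFun, real_inner_smul_left, inner_add_left]; ring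
  rw [e]
  by_cases h : i = 0
  · have := S.yw_pos k (i := i) (by rw [h]; exact hk.symm)
    have := S.yw_nonneg 0 i
    linarith
  · have := S.yw_pos 0 h
    have := S.yw_nonneg k i
    linarith

/-- An interior point of the alcove. -/
def x0 : V := S.exists_x0.choose
lemma x0_pos (i : Fin (S.n + 1)) : 0 < S.aFun i S.x0 := S.exists_x0.choose_spec i

/-- Negation of an affine root. -/
def negp (p : V × ℤ) : V × ℤ := (-p.1, -p.2)

lemma affval_negp {p : V × ℤ} (hp : p.1 ∈ S.R0) (x : V) :
    S.affval (negp p) x = - S.affval p x := by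
  have : S.m (-p.1) = S.m p.1 := S.m_congr (S.root_neg hp) hp (by simp)
  simp only [affval, negp, coroot_neg, inner_neg_right, this]
  push_cast
  ring

lemma pos_or_negp {p : V × ℤ} (hp : p.1 ∈ S.R0) : p ∈ S.RplusP ∨ negp p ∈ S.RplusP := by
  rcases lt_trichotomy p.2 0 with h | h | h
  · right; exact ⟨S.root_neg hp, Or.inl (by simp only [negp]; omega)⟩
  · rcases S.pos_or hp with h2 | h2
    · left; exact ⟨hp, Or.inr ⟨h, h2⟩⟩
    · right; exact ⟨S.root_neg hp, Or.inr ⟨by simp [negp, h], h2⟩⟩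
  · left; exact ⟨hp, Or.inl (by omega)⟩

lemma affval_ext {p : V × ℤ} {a k : ℝ} {β : V}
    (h : ∀ x, S.affval p x = a * (⟪x, coroot β⟫ + k)) :
    coroot p.1 = a • coroot β ∧ S.m p.1 * p.2 * S.c = a * k := by
  have h0 := h 0
  simp only [affval, inner_zero_left, zero_add] at h0
  refine ⟨?_, h0⟩
  refine ext_inner_left ℝ fun x => ?_
  have := h x
  rw [affval, h0] at this
  rw [real_inner_smul_right]
  linarith

lemma pos_x0 {p : V × ℤ} (hp : p ∈ S.RplusP) : 0 < S.affval p S.x0 := by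
  obtain ⟨c, hc, h⟩ := S.pos_comb hp
  have h1 : 0 ≤ S.affval p S.x0 := S.pos_nonneg hp fun i => (S.x0_pos i).le
  refine lt_of_le_of_ne h1 fun h0 => ?_
  rw [h, eq_comm, Finset.sum_eq_zero_iff_of_nonneg
    (fun i _ => mul_nonneg (hc i) (S.x0_pos i).le)] at h0
  have hc0 : ∀ i, c i = 0 := fun i => by
    have := h0 i (Finset.mem_univ _)
    exact (mul_eq_zero.mp this).resolve_right (S.x0_pos i).ne'
  have h2 := (S.affval_ext (p := p) (a := 0) (k := 0) (β := 0) (fun x => by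
    rw [h]; simp [hc0])).1
  have := S.inner_coroot_self hp.1
  rw [h2] at this
  simp at this

lemma pos_iff {p : V × ℤ} (hp : p.1 ∈ S.R0) : p ∈ S.RplusP ↔ 0 < S.affval p S.x0 := by
  refine ⟨S.pos_x0, fun h => ?_⟩
  rcases S.pos_or_negp hp with h1 | h1
  · exact h1
  · have := S.pos_x0 h1
    rw [S.affval_negp hp] at this
    linarith

lemma x0_ne {p : V × ℤ} (hp : p.1 ∈ S.R0) : S.affval p S.x0 ≠ 0 := by
  rcases S.pos_or_negp hp with h1 | h1
  · exact (S.pos_x0 h1).ne'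
  · have := S.pos_x0 h1
    rw [S.affval_negp hp] at this
    linarith

lemma pos_of_pos {p : V × ℤ} (hp : p.1 ∈ S.R0) {z : V} (hz : ∀ i, 0 ≤ S.aFun i z)
    (h : 0 < S.affval p z) : p ∈ S.RplusP := by
  rcases S.pos_or_negp hp with h1 | h1
  · exact h1
  · have := S.pos_nonneg h1 hz
    rw [S.affval_negp hp] at this
    linarith

lemma pair_ext {p q : V × ℤ} (hp : p.1 ∈ S.R0) (hq : q.1 ∈ S.R0) {a : ℝ} (ha : 0 ≤ a)
    (h : ∀ x, S.affval p x = a * S.affval q x) : p = q := by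
  obtain ⟨h1, h2⟩ := S.affval_ext h
  have hpp := S.root_inner_pos hp
  have hqq := S.root_inner_pos hq
  have e : p.1 = (⟪p.1, p.1⟫ / 2 * a * (2 / ⟪q.1, q.1⟫)) • q.1 := by
    have : p.1 = (⟪p.1, p.1⟫ / 2) • coroot p.1 := by
      rw [coroot, smul_smul]
      have : ⟪p.1, p.1⟫ / 2 * (2 / ⟪p.1, p.1⟫) = 1 := by field_simp
      rw [this, one_smul]
    conv_lhs => rw [this, h1]
    rw [coroot, smul_smul, smul_smul]
  set b := ⟪p.1, p.1⟫ / 2 * a * (2 / ⟪q.1, q.1⟫) with hb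
  have hb0 : 0 ≤ b := by positivity
  have hb1 : b = 1 := by
    rcases S.reduced q.1 hq b (e ▸ hp) with h | h
    · exact h
    · linarith
  have e1 : p.1 = q.1 := by rw [e, hb1, one_smul]
  have ha1 : a = 1 := by
    rw [hb, e1] at hb1
    field_simp at hb1
    linarith
  refine Prod.ext e1 ?_
  rw [e1, ha1, one_mul] at h2
  have h3 := (S.m_pos hq).ne'
  have h4 := S.c_pos.ne'
  have h5 := mul_left_cancel₀ h3 (mul_right_cancel₀ h4 h2)
  exact_mod_cast h5

lemma eq_apair {p : V × ℤ} (hp : p ∈ S.RplusP) {j : Fin (S.n + 1)}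
    (h0 : S.affval p (S.yw j) = 0) : p = S.apair j := by
  obtain ⟨c, hc, h⟩ := S.pos_comb hp
  rw [h, Finset.sum_eq_zero_iff_of_nonneg
    (fun i _ => mul_nonneg (hc i) (S.yw_nonneg j i))] at h0
  have hc0 : ∀ i, i ≠ j → c i = 0 := fun i hi => by
    have := h0 i (Finset.mem_univ _)
    exact (mul_eq_zero.mp this).resolve_right (S.yw_pos j hi).ne'
  refine S.pair_ext hp.1 (S.alpha_R0 j) (hc j) fun x => ?_
  rw [affval_apair, h, Finset.sum_eq_single j]
  · intro i _ hi; rw [hc0 i hi, zero_mul]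
  · simp

lemma exists_sp (j : Fin (S.n + 1)) (p : V × ℤ) : ∃ q : V × ℤ, p.1 ∈ S.R0 →
    (q.1 = p.1 - ⟪p.1, coroot (S.alpha j)⟫ • S.alpha j ∧ q.1 ∈ S.R0 ∧
      ∀ x, S.affval q x = S.affval p (S.sgen j x)) := by
  by_cases hp : p.1 ∈ S.R0
  swap
  · exact ⟨p, fun h => absurd h hp⟩
  have hj := S.alpha_R0 j
  set β := p.1 - ⟪p.1, coroot (S.alpha j)⟫ • S.alpha j with hβ
  have hβR : β ∈ S.R0 := S.refl_mem _ hj _ hp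
  have hn : ⟪β, β⟫ = ⟪p.1, p.1⟫ := S.refl_norm hj _
  have hm : S.m β = S.m p.1 := S.m_congr hβR hp hn
  have hk : ∃ k : ℤ, ⟪S.alpha j, coroot p.1⟫ * S.kconst j = S.m p.1 * k * S.c := by
    refine Fin.cases ?_ (fun i => ?_) j
    · rw [alpha_zero, kconst_zero]
      obtain ⟨k, hk⟩ := S.a0_int hp
      exact ⟨k, by rw [hk]⟩
    · exact ⟨0, by rw [kconst_succ]; simp⟩
  obtain ⟨k, hk⟩ := hk
  refine ⟨(β, p.2 - k), fun _ => ⟨rfl, hβR, fun x => ?_⟩⟩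
  have hpp := (S.root_inner_pos hp).ne'
  have haa := (S.root_inner_pos hj).ne'
  have e : ⟪x, coroot β⟫ = ⟪x, coroot p.1⟫ - ⟪x, coroot (S.alpha j)⟫ * ⟪S.alpha j, coroot p.1⟫ := by
    rw [inner_coroot, hn, hβ, inner_sub_right, real_inner_smul_right, inner_coroot, inner_coroot,
      inner_coroot, inner_coroot, real_inner_comm (S.alpha j) p.1]
    field_simp
  simp only [affval, hm, e]
  rw [sgen_apply, inner_sub_left, real_inner_smul_left, aFun]
  push_cast
  linarith

/-- The action of a simple reflection on affine roots. -/
def sp (j : Fin (S.n + 1)) (p : V × ℤ) : V × ℤ := (S.exists_sp j p).choose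

lemma sp_fst (j : Fin (S.n + 1)) {p : V × ℤ} (hp : p.1 ∈ S.R0) :
    (S.sp j p).1 = p.1 - ⟪p.1, coroot (S.alpha j)⟫ • S.alpha j :=
  ((S.exists_sp j p).choose_spec hp).1
lemma sp_R0 (j : Fin (S.n + 1)) {p : V × ℤ} (hp : p.1 ∈ S.R0) : (S.sp j p).1 ∈ S.R0 :=
  ((S.exists_sp j p).choose_spec hp).2.1
lemma affval_sp (j : Fin (S.n + 1)) {p : V × ℤ} (hp : p.1 ∈ S.R0) (x : V) :
    S.affval (S.sp j p) x = S.affval p (S.sgen j x) :=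
  ((S.exists_sp j p).choose_spec hp).2.2 x

lemma sp_sp (j : Fin (S.n + 1)) {p : V × ℤ} (hp : p.1 ∈ S.R0) : S.sp j (S.sp j p) = p := by
  refine S.pair_ext (S.sp_R0 j (S.sp_R0 j hp)) hp zero_le_one fun x => ?_
  rw [S.affval_sp j (S.sp_R0 j hp), S.affval_sp j hp, sgen_sgen, one_mul]

lemma t_sp (j : Fin (S.n + 1)) {p : V × ℤ} (hp : p.1 ∈ S.R0) : S.t (S.sp j p).1 = S.t p.1 := by
  rw [S.sp_fst j hp]; exact S.t_invariant _ (S.alpha_R0 j) _ hp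

lemma sgen_yw (j : Fin (S.n + 1)) : S.sgen j (S.yw j) = S.yw j := by
  rw [sgen_apply, yw_self, zero_smul, sub_zero]

lemma sp_pos (j : Fin (S.n + 1)) {p : V × ℤ} (hp : p ∈ S.RplusP) (hne : p ≠ S.apair j) :
    S.sp j p ∈ S.RplusP := by
  refine S.pos_of_pos (S.sp_R0 j hp.1) (S.yw_nonneg j) ?_
  rw [S.affval_sp j hp.1, sgen_yw]
  exact lt_of_le_of_ne (S.pos_nonneg hp (S.yw_nonneg j)) fun h => hne (S.eq_apair hp h.symm)

lemma rp_sp (j : Fin (S.n + 1)) {p : V × ℤ} (hp : p.1 ∈ S.R0) :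
    S.rp (S.sp j p) = S.sgen j * S.rp p * S.sgen j := by
  ext x
  show S.rp (S.sp j p) x = S.sgen j (S.rp p (S.sgen j x))
  rw [rp_apply, rp_apply, S.affval_sp j hp, S.sp_fst j hp]
  have e : ∀ (z : V) (s : ℝ), S.sgen j (z - s • p.1) =
      S.sgen j z - s • (p.1 - ⟪p.1, coroot (S.alpha j)⟫ • S.alpha j) := by
    intro z s
    rw [sgen_apply, sgen_apply, aFun, aFun, inner_sub_left, real_inner_smul_left]
    module
  rw [e, sgen_sgen]

end Setup


namespace Setup

variable (S : Setup V)
lemma inv_app (w : Equiv.Perm V) (x : V) : w⁻¹ (w x) = x := Equiv.symm_apply_apply w x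


/-- The product of a word. -/
def wp (l : List (Fin (S.n + 1))) : Equiv.Perm V := (l.map S.sgen).prod

lemma wp_nil : S.wp [] = 1 := rfl
lemma wp_cons (j : Fin (S.n + 1)) (l : List (Fin (S.n + 1))) :
    S.wp (j :: l) = S.sgen j * S.wp l := by simp [wp]
lemma wp_append (l l' : List (Fin (S.n + 1))) : S.wp (l ++ l') = S.wp l * S.wp l' := by
  simp [wp]
lemma wp_singleton (j : Fin (S.n + 1)) : S.wp [j] = S.sgen j := by simp [wp]

lemma wp_reverse (l : List (Fin (S.n + 1))) : S.wp l.reverse = (S.wp l)⁻¹ := by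
  induction l with
  | nil => simp [wp]
  | cons j l ih =>
    rw [List.reverse_cons, wp_append, wp_singleton, wp_cons, mul_inv_rev, ih, sgen_inv]

lemma rp_negp {p : V × ℤ} (hp : p.1 ∈ S.R0) : S.rp (negp p) = S.rp p := by
  ext x
  rw [rp_apply, rp_apply, S.affval_negp hp]
  simp [negp]

lemma affval_sub_smul (p : V × ℤ) (x v : V) (s : ℝ) :
    S.affval p (x - s • v) = S.affval p x - s * ⟪v, coroot p.1⟫ := by
  rw [affval, affval, inner_sub_left, real_inner_smul_left]; ring

lemma exists_inner_pos {p : V × ℤ} (hp : p ∈ S.RplusP) :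
    ∃ i, 0 < ⟪p.1, coroot (S.alpha i)⟫ := by
  by_contra hc
  push Not at hc
  obtain ⟨c, hc0, h⟩ := S.pos_comb hp
  have h1 := h p.1
  have h2 := h 0
  have h3 : S.affval p p.1 - S.affval p 0 = 2 := by
    simp only [affval, S.inner_coroot_self hp.1, inner_zero_left]; ring
  rw [h1, h2, ← Finset.sum_sub_distrib] at h3
  have : ∑ i, (c i * S.aFun i p.1 - c i * S.aFun i 0) ≤ 0 := by
    refine Finset.sum_nonpos fun i _ => ?_
    have e : c i * S.aFun i p.1 - c i * S.aFun i 0 = c i * ⟪p.1, coroot (S.alpha i)⟫ := by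
      simp only [aFun, inner_zero_left]; ring
    rw [e]
    exact mul_nonpos_of_nonneg_of_nonpos (hc0 i) (hc i)
  linarith

lemma rp_mem_closure {p : V × ℤ} (hp : p ∈ S.RplusP) :
    S.rp p ∈ Subgroup.closure (Set.range S.sgen) := by
  obtain ⟨i0, -, hmin⟩ := Finset.univ.exists_min_image (fun i => S.aFun i S.x0)
    ⟨0, Finset.mem_univ _⟩
  set δ := S.aFun i0 S.x0 with hδ
  have hδ0 : 0 < δ := S.x0_pos i0
  have key : ∀ N : ℕ, ∀ p ∈ S.RplusP, S.affval p S.x0 < N * δ →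
      S.rp p ∈ Subgroup.closure (Set.range S.sgen) := by
    intro N
    induction N with
    | zero =>
      intro p hp h
      have := S.pos_x0 hp
      simp at h; linarith
    | succ N ih =>
      intro p hp h
      obtain ⟨i, hi⟩ := S.exists_inner_pos hp
      have hgen : S.sgen i ∈ Subgroup.closure (Set.range S.sgen) :=
        Subgroup.subset_closure ⟨i, rfl⟩
      by_cases he : p = S.apair i
      · rw [he, rp_apair]; exact hgen
      have hsp := S.sp_pos i hp he
      have hval : S.affval (S.sp i p) S.x0 < N * δ := by
        rw [S.affval_sp i hp.1, sgen_apply, affval_sub_smul]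
        obtain ⟨k, hk⟩ := S.cryst p.1 hp.1 _ (S.alpha_R0 i)
        have hkpos : 0 < ⟪S.alpha i, coroot p.1⟫ := by
          have h1 := S.root_inner_pos hp.1
          have h2 := S.root_inner_pos (S.alpha_R0 i)
          rw [inner_coroot] at hi ⊢
          rw [real_inner_comm]
          have : 0 < ⟪p.1, S.alpha i⟫ := by
            by_contra hc
            push Not at hc
            have := div_nonpos_of_nonpos_of_nonneg (by linarith : 2 * ⟪p.1, S.alpha i⟫ ≤ 0) h2.le
            linarith
          positivity
        have hk1 : (1 : ℝ) ≤ ⟪S.alpha i, coroot p.1⟫ := by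
          rw [hk] at hkpos ⊢
          have : 0 < k := by exact_mod_cast hkpos
          exact_mod_cast (by omega : 1 ≤ k)
        have h3 := hmin i (Finset.mem_univ _)
        have h4 : S.aFun i S.x0 ≤ S.aFun i S.x0 * ⟪S.alpha i, coroot p.1⟫ :=
          le_mul_of_one_le_right (S.x0_pos i).le hk1
        push_cast at h
        linarith
      have h5 := ih _ hsp hval
      rw [S.rp_sp i hp.1] at h5
      have h6 := Subgroup.mul_mem _ (Subgroup.mul_mem _ hgen h5) hgen
      have e : S.sgen i * (S.sgen i * S.rp p * S.sgen i) * S.sgen i = S.rp p := by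
        rw [mul_assoc, mul_assoc, mul_assoc, sgen_mul_self, mul_one, ← mul_assoc, sgen_mul_self,
          one_mul]
      rwa [e] at h6
  obtain ⟨N, hN⟩ := exists_nat_gt (S.affval p S.x0 / δ)
  exact key N p hp (by rwa [div_lt_iff₀ hδ0] at hN)

lemma sgen_W (j : Fin (S.n + 1)) : S.sgen j ∈ S.W := by
  rw [← rp_apair]
  exact Subgroup.subset_closure ⟨_, S.alpha_R0 j, _, rfl⟩

lemma wp_W (l : List (Fin (S.n + 1))) : S.wp l ∈ S.W := by
  induction l with
  | nil => exact Subgroup.one_mem _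
  | cons j l ih => rw [wp_cons]; exact Subgroup.mul_mem _ (S.sgen_W j) ih

lemma exists_word {w : Equiv.Perm V} (hw : w ∈ S.W) : ∃ l, S.wp l = w := by
  have h1 : w ∈ Subgroup.closure (Set.range S.sgen) := by
    revert hw
    have : S.W ≤ Subgroup.closure (Set.range S.sgen) := by
      rw [W, Subgroup.closure_le]
      rintro w ⟨α, hα, r, rfl⟩
      have hp : ((α, r) : V × ℤ).1 ∈ S.R0 := hα
      show S.rp (α, r) ∈ Subgroup.closure (Set.range S.sgen)
      rcases S.pos_or_negp hp with h | h
      · exact S.rp_mem_closure h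
      · rw [← S.rp_negp hp]; exact S.rp_mem_closure h
    exact fun h => this h
  induction h1 using Subgroup.closure_induction with
  | mem x hx => obtain ⟨j, rfl⟩ := hx; exact ⟨[j], S.wp_singleton j⟩
  | one => exact ⟨[], rfl⟩
  | mul x y hx hy h1 h2 =>
    have hs : Subgroup.closure (Set.range S.sgen) ≤ S.W := by
      rw [Subgroup.closure_le]; rintro _ ⟨j, rfl⟩; exact S.sgen_W j
    obtain ⟨l1, rfl⟩ := h1 (hs hx)
    obtain ⟨l2, rfl⟩ := h2 (hs hy)
    exact ⟨l1 ++ l2, S.wp_append _ _⟩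
  | inv x hx h1 =>
    have hs : Subgroup.closure (Set.range S.sgen) ≤ S.W := by
      rw [Subgroup.closure_le]; rintro _ ⟨j, rfl⟩; exact S.sgen_W j
    obtain ⟨l1, rfl⟩ := h1 (hs hx)
    exact ⟨l1.reverse, S.wp_reverse _⟩

lemma len_le (l : List (Fin (S.n + 1))) : S.len (S.wp l) ≤ l.length :=
  Nat.sInf_le ⟨l, rfl, rfl⟩

lemma exists_red {w : Equiv.Perm V} (hw : w ∈ S.W) : ∃ l, S.wp l = w ∧ l.length = S.len w := by
  obtain ⟨l, hl⟩ := S.exists_word hw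
  have : S.len w ∈ {k | ∃ l : List (Fin (S.n + 1)), l.length = k ∧ (l.map S.sgen).prod = w} :=
    Nat.sInf_mem ⟨_, l, rfl, hl⟩
  obtain ⟨l', h1, h2⟩ := this
  exact ⟨l', h2, h1⟩

lemma len_inv_le {w : Equiv.Perm V} (hw : w ∈ S.W) : S.len w⁻¹ ≤ S.len w := by
  obtain ⟨l, rfl, h⟩ := S.exists_red hw
  rw [← h, ← wp_reverse, ← List.length_reverse]
  exact S.len_le _

lemma len_inv {w : Equiv.Perm V} (hw : w ∈ S.W) : S.len w⁻¹ = S.len w := by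
  refine le_antisymm (S.len_inv_le hw) ?_
  have := S.len_inv_le (Subgroup.inv_mem _ hw)
  rwa [inv_inv] at this

lemma len_mul_right_le {w : Equiv.Perm V} (hw : w ∈ S.W) (j : Fin (S.n + 1)) :
    S.len (w * S.sgen j) ≤ S.len w + 1 := by
  obtain ⟨l, rfl, h⟩ := S.exists_red hw
  rw [← wp_singleton, ← wp_append, ← h]
  refine (S.len_le _).trans (by simp)

lemma exchange (l : List (Fin (S.n + 1))) : ∀ p ∈ S.RplusP, S.affval p (S.wp l S.x0) < 0 →
    ∃ l' : List (Fin (S.n + 1)), l'.length + 1 = l.length ∧ S.wp l' = S.rp p * S.wp l := by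
  induction l with
  | nil =>
    intro p hp h
    have := S.pos_x0 hp
    simp [wp] at h
    linarith
  | cons i l ih =>
    intro p hp h
    by_cases he : p = S.apair i
    · refine ⟨l, rfl, ?_⟩
      rw [he, rp_apair, wp_cons, ← mul_assoc, sgen_mul_self, one_mul]
    · rw [wp_cons, Equiv.Perm.mul_apply, ← S.affval_sp i hp.1] at h
      obtain ⟨l', h1, h2⟩ := ih _ (S.sp_pos i hp he) h
      refine ⟨i :: l', by simp [h1], ?_⟩
      rw [wp_cons, wp_cons, h2, S.rp_sp i hp.1]
      simp only [← mul_assoc, sgen_mul_self, one_mul]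

lemma left_lt {w : Equiv.Perm V} (hw : w ∈ S.W) {k : Fin (S.n + 1)}
    (h : S.aFun k (w S.x0) < 0) : S.len (S.sgen k * w) < S.len w := by
  obtain ⟨l, rfl, hl⟩ := S.exists_red hw
  obtain ⟨l', h1, h2⟩ := S.exchange l (S.apair k) (S.apair_pos k) (by rwa [affval_apair])
  rw [rp_apair] at h2
  rw [← h2, ← hl, ← h1]
  exact Nat.lt_succ_of_le (S.len_le _)

lemma right_lt {w : Equiv.Perm V} (hw : w ∈ S.W) {k : Fin (S.n + 1)}
    (h : S.aFun k (w⁻¹ S.x0) < 0) : S.len (w * S.sgen k) < S.len w := by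
  have := S.left_lt (Subgroup.inv_mem _ hw) h
  rw [S.len_inv hw, ← S.len_inv (Subgroup.mul_mem _ (S.sgen_W k) (Subgroup.inv_mem _ hw)),
    mul_inv_rev, inv_inv, sgen_inv] at this
  exact this

lemma right_succ {w : Equiv.Perm V} (hw : w ∈ S.W) {k : Fin (S.n + 1)}
    (h : 0 < S.aFun k (w⁻¹ S.x0)) : S.len (w * S.sgen k) = S.len w + 1 := by
  have h1 := S.right_lt (Subgroup.mul_mem _ hw (S.sgen_W k)) (k := k) (by
    rw [mul_inv_rev, sgen_inv, Equiv.Perm.mul_apply, aFun_sgen]; linarith)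
  rw [mul_assoc, sgen_mul_self, mul_one] at h1
  have := S.len_mul_right_le hw k
  omega

lemma transport {w : Equiv.Perm V} (hw : w ∈ S.W) {p : V × ℤ} (hp : p.1 ∈ S.R0) :
    ∃ q : V × ℤ, q.1 ∈ S.R0 ∧ (∀ x, S.affval q x = S.affval p (w x)) ∧ S.t q.1 = S.t p.1 ∧
      S.rp q = w⁻¹ * S.rp p * w := by
  obtain ⟨l, rfl⟩ := S.exists_word hw
  clear hw
  induction l generalizing p with
  | nil => exact ⟨p, hp, fun x => rfl, rfl, by simp [wp]⟩
  | cons i l ih =>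
    obtain ⟨q, h1, h2, h3, h4⟩ := ih (S.sp_R0 i hp)
    refine ⟨q, h1, fun x => ?_, by rw [h3, S.t_sp i hp], ?_⟩
    · rw [h2, S.affval_sp i hp, wp_cons]; rfl
    · rw [h4, S.rp_sp i hp, wp_cons, mul_inv_rev, sgen_inv]
      simp only [mul_assoc]

lemma Raff_finite (x : V) : (S.Raff x).Finite := by
  have hc := S.c_pos
  refine Set.Finite.subset (Set.Finite.biUnion S.R0.finite_toSet (fun α _ =>
    (Set.finite_Icc (0 : ℤ) ⌈-⟪x, coroot α⟫ / (S.m α * S.c)⌉).image (fun r => (α, r)))) ?_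
  rintro ⟨α, r⟩ ⟨⟨h1, h2⟩, h3⟩
  simp only [Set.mem_iUnion]
  refine ⟨α, h1, r, ⟨?_, ?_⟩, rfl⟩
  · rcases h2 with h | h
    · simp only at h; omega
    · exact h.1.ge
  · have hm := S.m_pos (α := α) h1
    simp only [affval] at h3
    have : (r : ℝ) ≤ -⟪x, coroot α⟫ / (S.m α * S.c) := by
      rw [le_div_iff₀ (by positivity)]
      linarith
    exact_mod_cast this.trans (Int.le_ceil _)

lemma tBr_sgen {x : V} {j : Fin (S.n + 1)} (h : S.aFun j x < 0) :
    S.tBr x = (S.t (S.alpha j) : ℂ) * S.tBr (S.sgen j x) := by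
  have hmem : S.apair j ∈ S.Raff x := ⟨S.apair_pos j, by rwa [affval_apair]⟩
  have e : S.Raff x = insert (S.apair j) (S.Raff x \ {S.apair j}) := by
    rw [Set.insert_sdiff_singleton, Set.insert_eq_of_mem hmem]
  have hbij : Set.BijOn (S.sp j) (S.Raff x \ {S.apair j}) (S.Raff (S.sgen j x)) := by
    refine ⟨?_, ?_, ?_⟩
    · rintro p ⟨⟨h1, h2⟩, h3⟩
      exact ⟨S.sp_pos j h1 h3, by rw [S.affval_sp j h1.1, sgen_sgen]; exact h2⟩
    · rintro p ⟨⟨h1, h2⟩, h3⟩ q ⟨⟨h4, h5⟩, h6⟩ heq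
      rw [← S.sp_sp j h1.1, heq, S.sp_sp j h4.1]
    · rintro q ⟨h1, h2⟩
      have hne : q ≠ S.apair j := by
        rintro rfl
        rw [affval_apair, aFun_sgen] at h2
        linarith
      refine ⟨S.sp j q, ⟨⟨S.sp_pos j h1 hne, by rw [S.affval_sp j h1.1]; exact h2⟩, ?_⟩,
        S.sp_sp j h1.1⟩
      intro hq
      have hq : S.sp j q = S.apair j := hq
      have h3 := S.pos_x0 h1
      rw [← S.sgen_sgen j S.x0, ← S.affval_sp j h1.1, hq, affval_apair, aFun_sgen] at h3
      linarith [S.x0_pos j]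
  rw [tBr, e, finprod_mem_insert _ (by simp) ((S.Raff_finite x).subset Set.sdiff_subset), tBr]
  congr 1
  exact finprod_mem_eq_of_bijOn _ hbij fun p hp => by rw [S.t_sp j hp.1.1.1]

lemma tBr_ne (htne : ∀ α ∈ S.R0, S.t α ≠ 0) (x : V) : S.tBr x ≠ 0 := by
  refine finprod_mem_induction (fun z : ℂ => z ≠ 0) one_ne_zero (fun _ _ => mul_ne_zero) ?_
  intro p hp
  exact_mod_cast htne _ hp.1.1

lemma Alc_nonneg {z : V} (hz : z ∈ S.Alc) (i : Fin (S.n + 1)) : 0 ≤ S.aFun i z := by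
  refine Fin.cases ?_ (fun k => ?_) i
  · have := (hz _ S.neg_a0_mem).2
    have h1 := S.coroot_eq_hat (S.pos_subset S.neg_a0_mem)
    rw [m_neg_a0, one_smul, coroot_neg] at h1
    rw [← h1, inner_neg_right] at this
    rw [aFun_zero]; linarith
  · rw [aFun_succ, S.coroot_eq_hat (S.simple_R0 k), real_inner_smul_right]
    exact mul_nonneg (S.m_pos (S.simple_R0 k)).le (hz _ (S.simple_mem k)).1

lemma sign_transport {w : Equiv.Perm V} (hw : w ∈ S.W) {x : V} (hx : w x ∈ S.Alc)
    (j : Fin (S.n + 1)) :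
    (S.aFun j x < 0 → S.aFun j (w⁻¹ S.x0) < 0) ∧ (0 < S.aFun j x → 0 < S.aFun j (w⁻¹ S.x0)) := by
  obtain ⟨q, h1, h2, -, -⟩ := S.transport (Subgroup.inv_mem _ hw) (S.apair_pos j).1
  have e : S.affval q (w x) = S.aFun j x := by
    rw [h2, affval_apair, inv_app]
  have e0 : S.aFun j (w⁻¹ S.x0) = S.affval q S.x0 := by rw [h2, affval_apair]
  rw [e0, ← e]
  refine ⟨fun h => ?_, fun h => ?_⟩
  · by_contra hc
    have hc : 0 < S.affval q S.x0 := lt_of_le_of_ne (not_lt.mp hc) (S.x0_ne h1).symm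
    have := S.pos_nonneg ((S.pos_iff h1).mpr hc) (S.Alc_nonneg hx)
    linarith
  · exact S.pos_x0 (S.pos_of_pos h1 (S.Alc_nonneg hx) h)

lemma wmin_sgen {wmin : V → Equiv.Perm V} (hwmin : S.IsShortest wmin) {x : V}
    {j : Fin (S.n + 1)} (h : 0 < S.aFun j x) :
    wmin (S.sgen j x) = wmin x * S.sgen j ∧
      S.len (wmin x * S.sgen j) = S.len (wmin x) + 1 := by
  obtain ⟨a1, a2, a3⟩ := hwmin x
  obtain ⟨b1, b2, b3⟩ := hwmin (S.sgen j x)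
  have h1 := S.right_succ a1 ((S.sign_transport a1 a2 j).2 h)
  have h2 := S.right_lt b1 ((S.sign_transport b1 b2 j).1 (by rw [aFun_sgen]; linarith))
  obtain ⟨c1, -⟩ := a3 _ (Subgroup.mul_mem _ b1 (S.sgen_W j)) b2
  obtain ⟨d1, d2⟩ := b3 _ (Subgroup.mul_mem _ a1 (S.sgen_W j)) (by
    rw [Equiv.Perm.mul_apply, sgen_sgen]; exact a2)
  exact ⟨(d2 (by omega)).symm, h1⟩

lemma sgen_ne_one (j : Fin (S.n + 1)) : S.sgen j ≠ 1 := by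
  intro h
  have := S.aFun_sgen j S.x0
  rw [h, Equiv.Perm.one_apply] at this
  linarith [S.x0_pos j]

lemma wmin_zero {wmin : V → Equiv.Perm V} (hwmin : S.IsShortest wmin) {x : V}
    {j : Fin (S.n + 1)} (h : S.aFun j x = 0) :
    ∃ k, wmin x * S.sgen j = S.sgen k * wmin x ∧ S.aFun k (wmin x x) = 0 ∧
      S.len (wmin x * S.sgen j) = S.len (wmin x) + 1 ∧ S.t (S.alpha k) = S.t (S.alpha j) := by
  obtain ⟨a1, a2, a3⟩ := hwmin x
  set w := wmin x with hw
  have hfix : ∀ (i : Fin (S.n + 1)) (z : V), S.aFun i z = 0 → S.sgen i z = z := by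
    intro i z hz; rw [sgen_apply, hz, zero_smul, sub_zero]
  have hlen : S.len w < S.len (w * S.sgen j) := by
    obtain ⟨c1, c2⟩ := a3 _ (Subgroup.mul_mem _ a1 (S.sgen_W j)) (by
      rw [Equiv.Perm.mul_apply, hfix j x h]; exact a2)
    refine lt_of_le_of_ne c1 fun he => ?_
    have := c2 he.symm
    exact S.sgen_ne_one j (mul_left_cancel (this.trans (mul_one w).symm))
  have hlen1 : S.len (w * S.sgen j) = S.len w + 1 := by
    have := S.len_mul_right_le a1 j
    omega
  obtain ⟨q, h1, h2, -, -⟩ := S.transport (Subgroup.inv_mem _ a1) (S.apair_pos j).1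
  have hq0 : 0 < S.affval q S.x0 := by
    by_contra hc
    have hc : S.affval q S.x0 < 0 := lt_of_le_of_ne (not_lt.mp hc) (S.x0_ne h1)
    rw [h2, affval_apair] at hc
    have := S.right_lt a1 hc
    omega
  have hqpos := (S.pos_iff h1).mpr hq0
  obtain ⟨c, hc, hcomb⟩ := S.pos_comb hqpos
  have hqx : S.affval q (w x) = 0 := by
    rw [h2, affval_apair, inv_app]; exact h
  rw [hcomb, Finset.sum_eq_zero_iff_of_nonneg
    (fun i _ => mul_nonneg (hc i) (S.Alc_nonneg a2 i))] at hqx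
  have hex : ∃ k, c k ≠ 0 := by
    by_contra hn
    push Not at hn
    rw [hcomb] at hq0
    simp [hn] at hq0
  obtain ⟨k, hk⟩ := hex
  have hposk : ∀ i, c i ≠ 0 → S.aFun i (w x) = 0 ∧ 0 < S.aFun i (w S.x0) := by
    intro i hi
    have hi0 : S.aFun i (w x) = 0 :=
      (mul_eq_zero.mp (hqx i (Finset.mem_univ _))).resolve_left hi
    refine ⟨hi0, ?_⟩
    by_contra hn
    obtain ⟨r, r1, r2, -, -⟩ := S.transport a1 (S.apair_pos i).1
    have hne := S.x0_ne r1
    rw [r2, affval_apair] at hne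
    have hlt := S.left_lt a1 (lt_of_le_of_ne (not_lt.mp hn) hne)
    obtain ⟨c1, c2⟩ := a3 _ (Subgroup.mul_mem _ (S.sgen_W i) a1) (by
      rw [Equiv.Perm.mul_apply, hfix i _ hi0]; exact a2)
    omega
  have hnn : ∀ i, 0 ≤ c i * S.aFun i (w (S.yw j)) := by
    intro i
    by_cases hi : c i = 0
    · rw [hi, zero_mul]
    refine mul_nonneg (hc i) ?_
    obtain ⟨r, r1, r2, -, -⟩ := S.transport a1 (S.apair_pos i).1
    have hr : r ∈ S.RplusP := (S.pos_iff r1).mpr (by rw [r2, affval_apair]; exact (hposk i hi).2)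
    have := S.pos_nonneg hr (S.yw_nonneg j)
    rwa [r2, affval_apair] at this
  have hsum : ∑ i, c i * S.aFun i (w (S.yw j)) = 0 := by
    rw [← hcomb, h2, affval_apair, inv_app, yw_self]
  rw [Finset.sum_eq_zero_iff_of_nonneg (fun i _ => hnn i)] at hsum
  have hk0 := (mul_eq_zero.mp (hsum k (Finset.mem_univ _))).resolve_left hk
  obtain ⟨r, r1, r2, r3, r4⟩ := S.transport a1 (S.apair_pos k).1
  have hr : r ∈ S.RplusP := (S.pos_iff r1).mpr (by rw [r2, affval_apair]; exact (hposk k hk).2)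
  have hrj : r = S.apair j := S.eq_apair hr (by rw [r2, affval_apair, hk0])
  rw [hrj, rp_apair, rp_apair] at r4
  rw [hrj] at r3
  refine ⟨k, ?_, (hposk k hk).1, hlen1, r3.symm⟩
  rw [r4, mul_assoc, mul_inv_cancel_left]

end Setup


namespace Setup

variable (S : Setup V)

lemma ev_mem (f : ↥S.Plat → ℂ) {x : V} (h : x ∈ S.Plat) : S.ev f x = f ⟨x, h⟩ := by
  rw [ev, dif_pos h]

lemma ev_sub (f : ↥S.Plat → ℂ) (x : ↥S.Plat) : S.ev f x.1 = f x := S.ev_mem f x.2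

lemma ev_lin (a b : ℂ) (f g : ↥S.Plat → ℂ) (x : V) :
    S.ev (fun z => a * f z + b * g z) x = a * S.ev f x + b * S.ev g x := by
  unfold ev
  split_ifs <;> simp

lemma Plat_add {x y : V} (hx : x ∈ S.Plat) (hy : y ∈ S.Plat) : x + y ∈ S.Plat := by
  intro α hα
  obtain ⟨k, hk⟩ := hx α hα
  obtain ⟨l, hl⟩ := hy α hα
  exact ⟨k + l, by rw [inner_add_left, hk, hl]; push_cast; rfl⟩

lemma Plat_smul {x : V} (hx : x ∈ S.Plat) (r : ℤ) : (r : ℝ) • x ∈ S.Plat := by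
  intro α hα
  obtain ⟨k, hk⟩ := hx α hα
  exact ⟨r * k, by rw [real_inner_smul_left, hk]; push_cast; rfl⟩

lemma Plat_root {α : V} (h : α ∈ S.R0) : α ∈ S.Plat := fun β hβ => S.cryst β hβ α h

lemma Plat_string {x : V} (hx : x ∈ S.Plat) (j : Fin (S.n + 1)) (k : ℕ) :
    x + (k : ℝ) • S.alpha j ∈ S.Plat := by
  have := S.Plat_add hx (S.Plat_smul (S.Plat_root (S.alpha_R0 j)) k)
  simpa using this

lemma aFun_int {x : V} (hx : x ∈ S.Plat) (j : Fin (S.n + 1)) : ∃ k : ℤ, S.aFun j x = k := by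
  obtain ⟨k, hk⟩ := hx _ (S.alpha_R0 j)
  rw [aFun, hk]
  refine Fin.cases ?_ (fun i => ?_) j
  · exact ⟨k + S.c, by rw [kconst_zero]; push_cast; rfl⟩
  · exact ⟨k, by rw [kconst_succ, add_zero]⟩

lemma sgen_Plat {x : V} (hx : x ∈ S.Plat) (j : Fin (S.n + 1)) : S.sgen j x ∈ S.Plat := by
  obtain ⟨k, hk⟩ := S.aFun_int hx j
  rw [sgen_apply, hk]
  have := S.Plat_add hx (S.Plat_smul (S.Plat_root (S.alpha_R0 j)) (-k))
  convert this using 1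
  push_cast
  module

lemma W_Plat {w : Equiv.Perm V} (hw : w ∈ S.W) {x : V} (hx : x ∈ S.Plat) : w x ∈ S.Plat := by
  obtain ⟨l, rfl⟩ := S.exists_word hw
  clear hw
  induction l with
  | nil => exact hx
  | cons i l ih => rw [wp_cons]; exact S.sgen_Plat ih i

lemma sum_Icc_range (F : ℤ → ℂ) (N : ℕ) :
    ∑ k ∈ Finset.Icc (0 : ℤ) ((N : ℤ) - 1), F k = ∑ k ∈ Finset.range N, F (k : ℤ) := by
  refine (Finset.sum_nbij' (fun k : ℕ => (k : ℤ)) Int.toNat ?_ ?_ ?_ ?_ ?_).symm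
  · intro a ha; simp at ha ⊢; omega
  · intro a ha; simp at ha ⊢; omega
  · intro a ha; simp
  · intro a ha; simp at ha ⊢; omega
  · intro a ha; rfl

lemma sum_Icc_range' (F : ℤ → ℂ) (N : ℕ) :
    ∑ k ∈ Finset.Icc (1 : ℤ) (N : ℤ), F k = ∑ k ∈ Finset.range N, F ((N : ℤ) - k) := by
  refine (Finset.sum_nbij' (fun k : ℕ => (N : ℤ) - k) (fun k => ((N : ℤ) - k).toNat)
    ?_ ?_ ?_ ?_ ?_).symm
  · intro a ha; simp at ha ⊢; omega
  · intro a ha; simp at ha ⊢; omega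
  · intro a ha; simp
  · intro a ha; simp at ha ⊢; omega
  · intro a ha; rfl

lemma Jop_neg (j : Fin (S.n + 1)) (f : ↥S.Plat → ℂ) (z : ↥S.Plat) (N : ℕ)
    (h : S.aFun j z.1 = -(N : ℝ)) :
    S.Jop j f z = ∑ k ∈ Finset.range N, S.ev f (z.1 + (k : ℝ) • S.alpha j) := by
  have hf : Int.floor (S.aFun j z.1) = -(N : ℤ) := by
    rw [h]; exact_mod_cast Int.floor_intCast (R := ℝ) (-(N : ℤ))
  rw [Jop, hf, if_neg (by omega)]
  by_cases hN : N = 0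
  · subst hN; simp
  · rw [if_pos (by omega), neg_neg,
      sum_Icc_range (fun k : ℤ => S.ev f (z.1 + (k : ℝ) • S.alpha j))]
    simp

lemma Jop_pos (j : Fin (S.n + 1)) (f : ↥S.Plat → ℂ) (z : ↥S.Plat) (N : ℕ)
    (h : S.aFun j z.1 = (N : ℝ)) :
    S.Jop j f z = -∑ k ∈ Finset.range N, S.ev f (S.sgen j z.1 + (k : ℝ) • S.alpha j) := by
  have hf : Int.floor (S.aFun j z.1) = (N : ℤ) := by
    rw [h]; exact_mod_cast Int.floor_intCast (R := ℝ) (N : ℤ)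
  rw [Jop, hf]
  by_cases hN : N = 0
  · subst hN; simp
  · rw [if_pos (by omega), sum_Icc_range' (fun k : ℤ => S.ev f (z.1 - (k : ℝ) • S.alpha j))]
    congr 1
    refine Finset.sum_congr rfl fun k _ => ?_
    congr 1
    rw [sgen_apply, h]
    push_cast
    module

lemma nat_cases {x : V} (hx : x ∈ S.Plat) (j : Fin (S.n + 1)) :
    ∃ N : ℕ, S.aFun j x = N ∨ S.aFun j x = -(N : ℝ) := by
  obtain ⟨k, hk⟩ := S.aFun_int hx j
  refine ⟨k.natAbs, ?_⟩
  rcases Int.natAbs_eq k with h | h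
  · left; rw [hk, ← Int.cast_natCast]; exact congrArg (fun z : ℤ => (z : ℝ)) h
  · right; rw [hk, ← Int.cast_natCast, ← Int.cast_neg]; exact congrArg (fun z : ℤ => (z : ℝ)) h

lemma Jop_sgen (j : Fin (S.n + 1)) (f : ↥S.Plat → ℂ) (z : V) (hz : z ∈ S.Plat) :
    S.ev (S.Jop j f) (S.sgen j z) = - S.ev (S.Jop j f) z := by
  rw [S.ev_mem _ hz, S.ev_mem _ (S.sgen_Plat hz j)]
  obtain ⟨N, h | h⟩ := S.nat_cases hz j
  · rw [S.Jop_pos j f ⟨z, hz⟩ N h, neg_neg, S.Jop_neg j f ⟨S.sgen j z, S.sgen_Plat hz j⟩ N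
      (by rw [aFun_sgen, h])]
  · rw [S.Jop_neg j f ⟨z, hz⟩ N h, S.Jop_pos j f ⟨S.sgen j z, S.sgen_Plat hz j⟩ N
      (by rw [aFun_sgen, h, neg_neg]), sgen_sgen]

lemma ev_Top (j : Fin (S.n + 1)) (f : ↥S.Plat → ℂ) {z : V} (hz : z ∈ S.Plat) :
    S.ev (S.Top j f) z = (S.t (S.alpha j) : ℂ) * S.ev f (S.sgen j z) +
      ((S.t (S.alpha j) : ℂ) - 1) * S.ev (S.Jop j f) z := by
  rw [S.ev_mem _ hz, S.ev_mem (S.Jop j f) hz, Top, sgen_inv]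

lemma Jop_Top (j : Fin (S.n + 1)) (f : ↥S.Plat → ℂ) {y : V} (hy : y ∈ S.Plat) (N : ℕ)
    (h : S.aFun j y = -(N : ℝ)) :
    S.ev (S.Jop j (S.Top j f)) y = (S.t (S.alpha j) : ℂ) *
      (S.ev (S.Jop j f) y + S.ev f (S.sgen j y) - S.ev f y) +
      ((S.t (S.alpha j) : ℂ) - 1) * S.ev (S.Jop j f) y := by
  set E : ℕ → ℂ := fun k => S.ev f (y + (k : ℝ) • S.alpha j) with hE
  set D : ℕ → ℂ := fun k => S.ev (S.Jop j f) (y + (k : ℝ) • S.alpha j) with hD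
  have hs : ∀ k, k ≤ N → S.sgen j (y + (k : ℝ) • S.alpha j) =
      y + ((N - k : ℕ) : ℝ) • S.alpha j := by
    intro k hk
    rw [sgen_apply, aFun, inner_add_left, real_inner_smul_left,
      S.inner_coroot_self (S.alpha_R0 j)]
    have h' : ⟪y, coroot (S.alpha j)⟫ = -(N : ℝ) - S.kconst j := by rw [← h, aFun]; ring
    rw [h']
    push_cast [Nat.cast_sub hk]
    module
  have hT : ∀ k, k ≤ N → S.ev (S.Top j f) (y + (k : ℝ) • S.alpha j) =
      (S.t (S.alpha j) : ℂ) * E (N - k) + ((S.t (S.alpha j) : ℂ) - 1) * D k := by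
    intro k hk
    rw [S.ev_Top j f (S.Plat_string hy j k), hs k hk]
  have hDs : ∀ k, k ≤ N → D (N - k) = - D k := by
    intro k hk
    simp only [hD]
    rw [← hs k hk, S.Jop_sgen j f _ (S.Plat_string hy j k)]
  have hE0 : E 0 = S.ev f y := by simp [hE]
  have hEN : E N = S.ev f (S.sgen j y) := by
    have := hs 0 (Nat.zero_le _)
    simp at this
    simp only [hE]; rw [this]
  have hD0 : D 0 = S.ev (S.Jop j f) y := by simp [hD]
  have hS : ∑ k ∈ Finset.range N, E k = D 0 := by
    rw [hD0, S.ev_mem _ hy, S.Jop_neg j f ⟨y, hy⟩ N h]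
  have hE1 : ∑ k ∈ Finset.range N, E (N - k) = D 0 + E N - E 0 := by
    have h1 : ∑ k ∈ Finset.range N, E (N - k) = ∑ k ∈ Finset.range N, E (k + 1) := by
      rw [← Finset.sum_range_reflect]
      refine Finset.sum_congr rfl fun k hk => ?_
      rw [Finset.mem_range] at hk
      congr 1
      omega
    have h2 := Finset.sum_range_succ E N
    rw [Finset.sum_range_succ', hS] at h2
    rw [h1]
    linear_combination h2
  have hDsum : ∑ k ∈ Finset.range N, D k = D 0 := by
    have h1 := Finset.sum_range_reflect D (N + 1)
    have h2 : ∑ k ∈ Finset.range (N + 1), D (N + 1 - 1 - k) =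
        - ∑ k ∈ Finset.range (N + 1), D k := by
      rw [← Finset.sum_neg_distrib]
      refine Finset.sum_congr rfl fun k hk => ?_
      rw [Finset.mem_range] at hk
      rw [Nat.add_sub_cancel, hDs k (by omega)]
    rw [h2, Finset.sum_range_succ] at h1
    have h3 := hDs 0 (Nat.zero_le _)
    rw [Nat.sub_zero] at h3
    linear_combination (-1 / 2 : ℂ) * h1 - h3
  rw [S.ev_mem _ hy, S.Jop_neg j _ ⟨y, hy⟩ N h]
  rw [Finset.sum_congr rfl (fun k hk => hT k (Finset.mem_range.mp hk).le),
    Finset.sum_add_distrib, ← Finset.mul_sum, ← Finset.mul_sum, hE1, hDsum, hE0, hEN, hD0]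

lemma Top_sq (j : Fin (S.n + 1)) (f : ↥S.Plat → ℂ) :
    S.Top j (S.Top j f) = fun z => ((S.t (S.alpha j) : ℂ) - 1) * S.Top j f z +
      (S.t (S.alpha j) : ℂ) * f z := by
  have key : ∀ y (hy : y ∈ S.Plat), S.ev (S.Top j (S.Top j f)) y =
      ((S.t (S.alpha j) : ℂ) - 1) * S.ev (S.Top j f) y + (S.t (S.alpha j) : ℂ) * S.ev f y := by
    intro y hy
    have hsy := S.sgen_Plat hy j
    rw [S.ev_Top j _ hy, S.ev_Top j _ hsy, S.ev_Top j _ hy, sgen_sgen, S.Jop_sgen j f _ hy]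
    obtain ⟨N, h | h⟩ := S.nat_cases hy j
    · have h1 := S.Jop_Top j f hsy N (by rw [aFun_sgen, h])
      rw [S.Jop_sgen j _ _ hy, S.Jop_sgen j _ _ hy, sgen_sgen] at h1
      linear_combination (1 - (S.t (S.alpha j) : ℂ)) * h1
    · rw [S.Jop_Top j f hy N h]
      ring
  funext z
  have := key z.1 z.2
  simpa only [ev_sub] using this

lemma Jop_lin (j : Fin (S.n + 1)) (a b : ℂ) (f g : ↥S.Plat → ℂ) (z : ↥S.Plat) :
    S.Jop j (fun z => a * f z + b * g z) z = a * S.Jop j f z + b * S.Jop j g z := by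
  unfold Jop
  split_ifs
  · simp only [ev_lin, Finset.sum_add_distrib, ← Finset.mul_sum]; ring
  · simp only [ev_lin, Finset.sum_add_distrib, ← Finset.mul_sum]
  · ring

lemma Top_lin (j : Fin (S.n + 1)) (a b : ℂ) (f g : ↥S.Plat → ℂ) :
    S.Top j (fun z => a * f z + b * g z) = fun z => a * S.Top j f z + b * S.Top j g z := by
  funext z
  simp only [Top, ev_lin, Jop_lin]
  ring

lemma wordOp_cons (j : Fin (S.n + 1)) (l : List (Fin (S.n + 1))) (f : ↥S.Plat → ℂ) :
    S.wordOp (j :: l) f = S.Top j (S.wordOp l f) := rfl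

lemma wordOp_snoc (j : Fin (S.n + 1)) (l : List (Fin (S.n + 1))) (f : ↥S.Plat → ℂ) :
    S.wordOp (l ++ [j]) f = S.wordOp l (S.Top j f) := by
  induction l with
  | nil => rfl
  | cons i l ih => rw [List.cons_append, wordOp_cons, wordOp_cons, ih]

lemma wordOp_lin (l : List (Fin (S.n + 1))) (a b : ℂ) (f g : ↥S.Plat → ℂ) :
    S.wordOp l (fun z => a * f z + b * g z) =
      fun z => a * S.wordOp l f z + b * S.wordOp l g z := by
  induction l with
  | nil => rfl
  | cons i l ih => rw [wordOp_cons, ih, Top_lin]; rfl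

section TWsec

variable {TW : Equiv.Perm V → (↥S.Plat → ℂ) → (↥S.Plat → ℂ)}

lemma TW_lin (hTW : S.IsTW TW) {w : Equiv.Perm V} (hw : w ∈ S.W) (a b : ℂ)
    (f g : ↥S.Plat → ℂ) :
    TW w (fun z => a * f z + b * g z) = fun z => a * TW w f z + b * TW w g z := by
  obtain ⟨l, h1, h2⟩ := S.exists_red hw
  rw [hTW w l ⟨h1, h2⟩, wordOp_lin]

lemma TW_right (hTW : S.IsTW TW) {w : Equiv.Perm V} (hw : w ∈ S.W) {j : Fin (S.n + 1)}
    (h : S.len (w * S.sgen j) = S.len w + 1) (f : ↥S.Plat → ℂ) :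
    TW (w * S.sgen j) f = TW w (S.Top j f) := by
  obtain ⟨l, h1, h2⟩ := S.exists_red hw
  rw [hTW w l ⟨h1, h2⟩, hTW (w * S.sgen j) (l ++ [j])
    ⟨by have := S.wp_append l [j]; rwa [wp_singleton, h1] at this, by simp [h, h2]⟩, wordOp_snoc]

lemma TW_left (hTW : S.IsTW TW) {w : Equiv.Perm V} (hw : w ∈ S.W) {j : Fin (S.n + 1)}
    (h : S.len (S.sgen j * w) = S.len w + 1) (f : ↥S.Plat → ℂ) :
    TW (S.sgen j * w) f = S.Top j (TW w f) := by
  obtain ⟨l, h1, h2⟩ := S.exists_red hw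
  rw [hTW w l ⟨h1, h2⟩, hTW (S.sgen j * w) (j :: l)
    ⟨by have := S.wp_cons j l; rwa [h1] at this, by simp [h, h2]⟩, wordOp_cons]

end TWsec

lemma Winv_iff (f : ↥S.Plat → ℂ) :
    S.Winv f ↔ ∀ (j : Fin (S.n + 1)) (x : ↥S.Plat), S.ev f (S.sgen j x.1) = f x := by
  refine ⟨fun h j x => ?_, fun h w hw x => ?_⟩
  · have := h _ (S.sgen_W j) x
    rwa [sgen_inv] at this
  · obtain ⟨l, hl⟩ := S.exists_word (Subgroup.inv_mem _ hw)
    rw [← hl]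
    clear hl
    induction l with
    | nil => exact S.ev_sub f x
    | cons i l ih =>
      have hm := S.W_Plat (S.wp_W l) x.2
      have := h i ⟨_, hm⟩
      rw [wp_cons, Equiv.Perm.mul_apply, this, ← S.ev_mem f hm, ih]

section JJsec

variable {wmin : V → Equiv.Perm V} {TW : Equiv.Perm V → (↥S.Plat → ℂ) → (↥S.Plat → ℂ)}

lemma JJ_pos (htne : ∀ α ∈ S.R0, S.t α ≠ 0) (hwmin : S.IsShortest wmin) (hTW : S.IsTW TW)
    (g : ↥S.Plat → ℂ) (j : Fin (S.n + 1)) (x : ↥S.Plat) (h : 0 < S.aFun j x.1) :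
    S.JJ wmin TW (S.Top j g) x =
      (S.t (S.alpha j) : ℂ) * S.ev (S.JJ wmin TW g) (S.sgen j x.1) := by
  obtain ⟨h1, h2⟩ := S.wmin_sgen hwmin h
  have ht : (S.t (S.alpha j) : ℂ) ≠ 0 := by exact_mod_cast htne _ (S.alpha_R0 j)
  have hb := S.tBr_ne htne x.1
  have e := S.tBr_sgen (x := S.sgen j x.1) (j := j) (by rw [aFun_sgen]; linarith)
  rw [sgen_sgen] at e
  rw [S.ev_mem _ (S.sgen_Plat x.2 j), JJ, JJ]
  simp only
  rw [h1, S.TW_right hTW (hwmin x.1).1 h2, e, Equiv.Perm.mul_apply, sgen_sgen]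
  field_simp

lemma JJ_neg (htne : ∀ α ∈ S.R0, S.t α ≠ 0) (hwmin : S.IsShortest wmin) (hTW : S.IsTW TW)
    (g : ↥S.Plat → ℂ) (j : Fin (S.n + 1)) (x : ↥S.Plat) (h : S.aFun j x.1 < 0) :
    S.JJ wmin TW (S.Top j g) x =
      ((S.t (S.alpha j) : ℂ) - 1) * S.JJ wmin TW g x + S.ev (S.JJ wmin TW g) (S.sgen j x.1) := by
  obtain ⟨h1, h2⟩ := S.wmin_sgen hwmin (x := S.sgen j x.1) (j := j)
    (by rw [aFun_sgen]; linarith)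
  rw [sgen_sgen] at h1
  have ht : (S.t (S.alpha j) : ℂ) ≠ 0 := by exact_mod_cast htne _ (S.alpha_R0 j)
  have hb := S.tBr_ne htne (S.sgen j x.1)
  have e := S.tBr_sgen h
  have hw := (hwmin (S.sgen j x.1)).1
  rw [S.ev_mem _ (S.sgen_Plat x.2 j), JJ, JJ, JJ]
  simp only
  rw [h1, S.TW_right hTW hw h2, S.TW_right hTW hw h2, e, Equiv.Perm.mul_apply, Top_sq,
    S.TW_lin hTW hw, ev_lin]
  field_simp

lemma JJ_zero (hwmin : S.IsShortest wmin) (hTW : S.IsTW TW)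
    (g : ↥S.Plat → ℂ) (j : Fin (S.n + 1)) (x : ↥S.Plat) (h : S.aFun j x.1 = 0) :
    S.JJ wmin TW (S.Top j g) x = (S.t (S.alpha j) : ℂ) * S.JJ wmin TW g x := by
  obtain ⟨k, h1, h2, h3, h4⟩ := S.wmin_zero hwmin h
  have hw := (hwmin x.1).1
  have hm := S.W_Plat hw x.2
  rw [JJ, JJ, ← S.TW_right hTW hw h3, h1, S.TW_left hTW hw (by rw [← h1, h3]),
    S.ev_Top k _ hm, S.ev_mem (S.Jop k _) hm, S.Jop_pos k _ ⟨_, hm⟩ 0 (by simpa using h2),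
    sgen_apply, h2, h4]
  simp
  ring

end JJsec

end Setup




/-- a function `f ∈ 𝒞(P)` is `W`-invariant iff `𝒥 T_j 𝒥⁻¹ f = t_j f` for
every `j ∈ {0, 1, …, n}`. -/
theorem statement6 (S : Setup V) (htne : ∀ α ∈ S.R0, S.t α ≠ 0)
    (wmin : V → Equiv.Perm V) (hwmin : S.IsShortest wmin)
    (TW : Equiv.Perm V → (↥S.Plat → ℂ) → (↥S.Plat → ℂ)) (hTW : S.IsTW TW)
    (K : (↥S.Plat → ℂ) → (↥S.Plat → ℂ))
    (hK : ∀ f, S.JJ wmin TW (K f) = f ∧ K (S.JJ wmin TW f) = f)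
    (f : ↥S.Plat → ℂ) :
    S.Winv f ↔ ∀ (j : Fin (S.n + 1)) (x : ↥S.Plat),
      S.JJ wmin TW (S.Top j (K f)) x = (S.t (S.alpha j) : ℂ) * f x := by
  obtain ⟨hg, -⟩ := hK f
  set g := K f with hgdef
  rw [S.Winv_iff]
  refine forall_congr' fun j => forall_congr' fun x => ?_
  have ht : (S.t (S.alpha j) : ℂ) ≠ 0 := by exact_mod_cast htne _ (S.alpha_R0 j)
  rcases lt_trichotomy (S.aFun j x.1) 0 with h | h | h
  · rw [S.JJ_neg htne hwmin hTW g j x h, hg]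
    constructor
    · intro h1; rw [h1]; ring
    · intro h1; linear_combination h1
  · rw [S.JJ_zero hwmin hTW g j x h, hg, S.sgen_apply, h, zero_smul, sub_zero, S.ev_sub]
    simp
  · rw [S.JJ_pos htne hwmin hTW g j x h, hg, mul_right_inj' ht]

end AffinePieri
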